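/- Let I be a Coxeter-Dynkin diagram with Coxeter group W_I and positive braid monoid B⁺_I, and fix a nonreduced element b ∈ B⁺_I. Then the poset Word_fn(b) of factorizations of b into sequences of finite-type braid-lifts of Coxeter elements, at least one letter of which is nonreduced (more precisely: sequences (b₁,…,bₙ) with b₁⋯bₙ = b, each bᵢ finite type, and not all bᵢ reduced), ordered by refinement, is contractible (its nerve is weakly homotopy equivalent to a point). -/

import Mathlib

/-!
STATEMENT 13.  Let `I` be a Coxeter–Dynkin diagram (a Coxeter matrix `M`) with
Coxeter group `W_I` and positive braid monoid `B⁺_I`, and fix a nonreduced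
element `b ∈ B⁺_I`.  Then the poset `Word_fn(b)` of factorizations of `b` into
sequences of nonidentity finite-type elements, at least one letter of which is
nonreduced, ordered by refinement (block multiplication), is contractible: its
nerve is homotopy equivalent to a point.
-/

open CoxeterSystem CategoryTheory

variable {B : Type}

/-- The braid relations associated to a Coxeter matrix `M`. -/
def CoxeterMatrix.braidRels (M : CoxeterMatrix B) :
    FreeMonoid B → FreeMonoid B → Prop := fun a b =>
  ∃ i i' : B,
    a = FreeMonoid.ofList (alternatingWord i i' (M i i')) ∧
    b = FreeMonoid.ofList (alternatingWord i' i (M i i'))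

/-- The positive braid monoid of a Coxeter matrix `M`. -/
def CoxeterMatrix.BraidMonoid (M : CoxeterMatrix B) : Type _ :=
  PresentedMonoid M.braidRels

noncomputable instance (M : CoxeterMatrix B) : Monoid M.BraidMonoid :=
  inferInstanceAs (Monoid (PresentedMonoid M.braidRels))

/-- The image in the braid monoid of a word in the generators. -/
def CoxeterMatrix.braidMk (M : CoxeterMatrix B) (l : List B) : M.BraidMonoid :=
  PresentedMonoid.mk M.braidRels (FreeMonoid.ofList l)

/-- A braid monoid element is reduced if it is the braid lift of a reduced word
of the Coxeter group, i.e. some (equivalently, any) word representing it is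
reduced. -/
def CoxeterMatrix.ReducedBraid (M : CoxeterMatrix B) (b : M.BraidMonoid) : Prop :=
  ∃ l : List B, M.braidMk l = b ∧ M.toCoxeterSystem.IsReduced l

/-- A braid monoid element is finite type if the letters involved in it
generate a finite (standard parabolic) subgroup of the Coxeter group. -/
def CoxeterMatrix.FiniteTypeBraid (M : CoxeterMatrix B) (b : M.BraidMonoid) : Prop :=
  ∃ l : List B, M.braidMk l = b ∧
    (Subgroup.closure (M.simple '' {i | i ∈ l}) : Set M.Group).Finite

/-- One step of the refinement (coarsening) order on factorizations in a
monoid: `l` refines `l'` if `l'` is obtained from `l` by multiplying together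
consecutive blocks. -/
def ListRefines {N : Type*} [Monoid N] (l l' : List N) : Prop :=
  ∃ L : List (List N), L.flatten = l ∧ L.map List.prod = l'

/-- The poset `Word_fn(b)`: factorizations of `b` into sequences of nonidentity
finite-type braid elements, not all of which are reduced. -/
structure WordFN (M : CoxeterMatrix B) (b : M.BraidMonoid) where
  letters : List M.BraidMonoid
  prod_eq : letters.prod = b
  ne_one : ∀ x ∈ letters, x ≠ 1
  finite : ∀ x ∈ letters, M.FiniteTypeBraid x
  not_all_reduced : ¬ ∀ x ∈ letters, M.ReducedBraid x

noncomputable instance (M : CoxeterMatrix B) (b : M.BraidMonoid) :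
    Preorder (WordFN M b) where
  le := Relation.ReflTransGen fun x y => ListRefines x.letters y.letters
  le_refl _ := Relation.ReflTransGen.refl
  le_trans _ _ _ h h2 := Relation.ReflTransGen.trans h h2

section partT1

open CategoryTheory

namespace WFN

/-- every point of a simplex comes from its support face -/
lemma exists_supp {n : ℕ} (t : stdSimplex ℝ (Fin (n + 1))) :
    ∃ (k : ℕ) (e : Fin (k + 1) ↪o Fin (n + 1)) (u : stdSimplex ℝ (Fin (k + 1))),
      stdSimplex.map e u = t ∧ ∀ i, i ∈ Set.range e ↔ t i ≠ 0 := by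
  classical
  set s : Finset (Fin (n + 1)) := Finset.univ.filter (fun i => t i ≠ 0) with hs
  have hne : s.Nonempty := by
    by_contra h
    rw [Finset.not_nonempty_iff_eq_empty] at h
    have h1 := stdSimplex.sum_eq_one t
    have : ∑ x, t x = 0 := Finset.sum_eq_zero (fun i _ => by
      by_contra h2
      have : i ∈ s := by simp [hs, h2]
      simp [h] at this)
    linarith
  obtain ⟨k, hk⟩ : ∃ k, s.card = k + 1 := ⟨s.card - 1, by have := hne.card_pos; omega⟩
  let e := s.orderEmbOfFin hk
  have hr : ∀ i, i ∈ Set.range e ↔ t i ≠ 0 := by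
    intro i
    simp [e, Finset.range_orderEmbOfFin, hs]
  have hsum : ∑ j, t (e j) = 1 := by
    rw [← stdSimplex.sum_eq_one t]
    apply Finset.sum_of_injOn e
    · exact e.injective.injOn
    · simp
    · intro i _ hi
      by_contra h
      exact hi (by simpa using (hr i).2 h)
    · simp
  refine ⟨k, e, ⟨fun j => t (e j), fun j => stdSimplex.zero_le t _, hsum⟩, ?_, hr⟩
  ext i
  rw [stdSimplex.map_coe, FunOnFinite.linearMap_apply_apply]
  by_cases h : t i = 0
  · rw [Finset.sum_eq_zero]
    · exact h.symm
    · intro j hj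
      simp only [Finset.mem_filter, Finset.mem_univ, true_and] at hj
      change t (e j) = 0
      rw [hj]
      exact h
  · obtain ⟨j, hj⟩ := (hr i).2 h
    subst hj
    have : (Finset.univ.filter (fun j' => e j' = e j)) = {j} := by
      ext; simp
    rw [this, Finset.sum_singleton]
    rfl

lemma map_apply {X Y : Type} [Fintype X] [Fintype Y] [DecidableEq Y] (f : X → Y)
    (t : stdSimplex ℝ X) (y : Y) :
    stdSimplex.map f t y = ∑ x with f x = y, t x := by
  rw [stdSimplex.map_coe, FunOnFinite.linearMap_apply_apply]

lemma map_apply_inj {X Y : Type} [Fintype X] [Fintype Y] (f : X → Y) (hf : Function.Injective f)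
    (t : stdSimplex ℝ X) (x : X) :
    stdSimplex.map f t (f x) = t x := by
  classical
  rw [map_apply]
  have : (Finset.univ.filter (fun j' => f j' = f x)) = {x} := by
    ext; simp [hf.eq_iff]
  rw [this, Finset.sum_singleton]

lemma map_inj {X Y : Type} [Fintype X] [Fintype Y] (f : X → Y) (hf : Function.Injective f) :
    Function.Injective (stdSimplex.map (S := ℝ) f) := by
  intro t t' h
  ext x
  have := congrArg (fun (r : stdSimplex ℝ Y) => r (f x)) h
  simpa [map_apply_inj f hf] using this

lemma map_ne_zero {X Y : Type} [Fintype X] [Fintype Y] (f : X → Y)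
    (t : stdSimplex ℝ X) (x : X) (h : t x ≠ 0) : stdSimplex.map f t (f x) ≠ 0 := by
  classical
  rw [map_apply]
  have h1 : t x ≤ ∑ z with f z = f x, t z :=
    Finset.single_le_sum (f := fun z => t z) (fun i _ => stdSimplex.zero_le t i) (by simp)
  have h2 := stdSimplex.zero_le t x
  have h3 : 0 < t x := lt_of_le_of_ne h2 (Ne.symm h)
  linarith [h1]

lemma map_ne_zero' {X Y : Type} [Fintype X] [Fintype Y] (f : X → Y)
    (t : stdSimplex ℝ X) (y : Y) (h : stdSimplex.map f t y ≠ 0) : ∃ x, f x = y := by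
  classical
  rw [map_apply] at h
  obtain ⟨x, hx, -⟩ := Finset.exists_ne_zero_of_sum_ne_zero h
  exact ⟨x, by simpa using hx⟩

section fill
variable {n : ℕ} {Z : Type} [TopologicalSpace Z]
  (g : ∀ (k : ℕ) (θ : Fin (k+1) →o Fin (n+1)), ¬ Function.Surjective θ →
    C(stdSimplex ℝ (Fin (k+1)), Z))
  (nat : ∀ (k k' : ℕ) (θ : Fin (k+1) →o Fin (n+1)) (θ' : Fin (k'+1) →o Fin (k+1)) h h' t,
    g k' (θ.comp θ') h' t = g k θ h (stdSimplex.map θ' t))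

include nat in
lemma fill_wd {k k' : ℕ} (θ : Fin (k+1) →o Fin (n+1)) (hθ : ¬ Function.Surjective θ)
    (t' : stdSimplex ℝ (Fin (k+1))) (e : Fin (k'+1) ↪o Fin (n+1)) 
    (he : ¬ Function.Surjective e.toOrderHom) (u : stdSimplex ℝ (Fin (k'+1)))
    (h : stdSimplex.map θ t' = stdSimplex.map e u) 
    (hr : ∀ i, i ∈ Set.range e ↔ stdSimplex.map e u i ≠ 0) :
    g k θ hθ t' = g k' e.toOrderHom he u := by
  obtain ⟨l, e', u', hu', hr'⟩ := exists_supp t'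
  have key : ∀ j, ∃ i, e i = θ (e' j) := by
    intro j
    have : t' (e' j) ≠ 0 := (hr' _).1 ⟨j, rfl⟩
    have := map_ne_zero θ t' _ this
    rw [h] at this
    exact (hr _).2 this
  choose ρ hρ using key
  let ρ' : Fin (l+1) →o Fin (k'+1) := ⟨ρ, fun a b hab => by
    rw [← e.le_iff_le, hρ, hρ]
    exact θ.monotone (e'.monotone hab)⟩
  have hcomp : θ.comp e'.toOrderHom = e.toOrderHom.comp ρ' := by
    ext j : 2
    exact (hρ j).symm
  have h1 : ¬ Function.Surjective (θ.comp e'.toOrderHom) := by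
    intro h; exact hθ (Function.Surjective.of_comp h)
  have h2 : ¬ Function.Surjective (e.toOrderHom.comp ρ') := hcomp ▸ h1
  have e1 : g k θ hθ t' = g l (θ.comp e'.toOrderHom) h1 u' := by
    rw [nat k l θ e'.toOrderHom hθ h1 u']
    exact congrArg _ hu'.symm
  have e2 : g l (θ.comp e'.toOrderHom) h1 u' = g l (e.toOrderHom.comp ρ') h2 u' := by
    congr 2
  rw [e1, e2, nat k' l e.toOrderHom ρ' he h2 u']
  congr 1
  apply map_inj e e.injective
  rw [← h, ← hu', stdSimplex.map_comp_apply, stdSimplex.map_comp_apply]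
  congr 1
  ext j : 1
  exact hρ j

include nat in
lemma fill_bdry (z0 : Z) : ∃ F : stdSimplex ℝ (Fin (n+1)) → Z,
    (∀ k (θ : Fin (k+1) →o Fin (n+1)) (hθ : ¬ Function.Surjective θ) t, 
      F (stdSimplex.map θ t) = g k θ hθ t) ∧
    ∀ i, ContinuousOn F {t | t i = 0} := by
  classical
  choose k e u hu hr using fun t => exists_supp (n := n) t
  let F : stdSimplex ℝ (Fin (n+1)) → Z := fun t => 
    if h : Function.Surjective (e t).toOrderHom then z0 else g (k t) (e t).toOrderHom h (u t)
  have hF : ∀ k (θ : Fin (k+1) →o Fin (n+1)) (hθ : ¬ Function.Surjective θ) t, 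
      F (stdSimplex.map θ t) = g k θ hθ t := by
    intro k' θ hθ t
    have h : ¬ Function.Surjective (e (stdSimplex.map θ t)).toOrderHom := by
      intro h
      apply hθ
      intro i
      obtain ⟨j, hj⟩ := h i
      have := (hr (stdSimplex.map θ t) i).1 ⟨j, hj⟩
      exact map_ne_zero' _ _ _ this
    simp only [F, h, dif_neg, not_false_eq_true]
    symm
    apply fill_wd g nat
    · exact (hu _).symm
    · intro i
      rw [hu]
      exact hr _ i
  refine ⟨F, hF, ?_⟩
  intro i
  obtain _ | n := n
  · have : {t : stdSimplex ℝ (Fin (0+1)) | t i = 0} = ∅ := by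
      ext t
      have := stdSimplex.sum_eq_one t
      have hi : i = 0 := Fin.eq_zero i
      have h2 : t 0 = 1 := by simp
      simp only [Set.mem_ofPred_eq, Set.mem_empty_iff_false, iff_false, hi, h2]
      norm_num
    rw [this]
    exact continuousOn_empty _
  · rw [continuousOn_iff_continuous_domRestrict]
    let r : {t : stdSimplex ℝ (Fin (n+1+1)) | t i = 0} → stdSimplex ℝ (Fin (n+1)) := fun t =>
      ⟨fun j => t.1 (i.succAbove j), fun j => stdSimplex.zero_le _ _, by
        have h1 := stdSimplex.sum_eq_one t.1
        rw [Fin.sum_univ_succAbove _ i] at h1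
        have h2 : t.1 i = 0 := t.2
        rw [h2, zero_add] at h1
        exact h1⟩
    have hrc : Continuous r := by
      apply Continuous.subtype_mk
      apply continuous_pi
      intro j
      exact (continuous_apply (i.succAbove j)).comp (continuous_subtype_val.comp continuous_subtype_val)
    have hns : ¬ Function.Surjective (Fin.succAboveOrderEmb i).toOrderHom := by
      intro h
      obtain ⟨j, hj⟩ := h i
      exact Fin.succAbove_ne i j hj
    have : Set.domRestrict {t | t i = 0} F = fun t => g n (Fin.succAboveOrderEmb i).toOrderHom hns (r t) := by
      ext t
      rw [← hF]
      change F t.1 = _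
      congr 1
      ext j
      change t.1 j = stdSimplex.map (Fin.succAbove i) (r t) j
      by_cases hj : j = i
      · subst hj
        have h2 : t.1 j = 0 := t.2
        rw [h2]
        by_contra h
        obtain ⟨x, hx⟩ := map_ne_zero' _ _ _ (Ne.symm h)
        exact Fin.succAbove_ne j x hx
      · obtain ⟨l, rfl⟩ := Fin.exists_succAbove_eq hj
        rw [map_apply_inj _ Fin.succAbove_right_injective]
        rfl
    rw [this]
    exact (ContinuousMap.continuous _).comp hrc

lemma fill_exists [ContractibleSpace Z]
    (g : ∀ (k : ℕ) (θ : Fin (k+1) →o Fin (n+1)), ¬ Function.Surjective θ →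
      C(stdSimplex ℝ (Fin (k+1)), Z))
    (nat : ∀ (k k' : ℕ) (θ : Fin (k+1) →o Fin (n+1)) (θ' : Fin (k'+1) →o Fin (k+1)) h h' t,
      g k' (θ.comp θ') h' t = g k θ h (stdSimplex.map θ' t)) :
    ∃ G : C(stdSimplex ℝ (Fin (n+1)), Z), ∀ k (θ : Fin (k+1) →o Fin (n+1)) 
      (hθ : ¬ Function.Surjective θ) t, G (stdSimplex.map θ t) = g k θ hθ t := by
  classical
  obtain ⟨z0, ⟨H⟩⟩ := id_nullhomotopic Z
  obtain ⟨F, hF, hFc⟩ := fill_bdry g nat z0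
  let m : stdSimplex ℝ (Fin (n+1)) → ℝ := fun t => Finset.univ.inf' Finset.univ_nonempty (fun i => t i)
  have hmc : Continuous m := by
    have : Continuous (fun t : stdSimplex ℝ (Fin (n+1)) => 
      Finset.univ.inf' Finset.univ_nonempty (fun i => (t : Fin (n+1) → ℝ) i)) := by
      apply Continuous.finset_inf'_apply
      intro i _
      exact (continuous_apply i).comp continuous_subtype_val
    exact this
  have hm0 : ∀ t, 0 ≤ m t := fun t => by
    apply Finset.le_inf'
    intro i _
    exact stdSimplex.zero_le t i
  have hml : ∀ t i, m t ≤ t i := fun t i => Finset.inf'_le _ (Finset.mem_univ i)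
  have hex : ∀ t, ∃ i, t i = m t := fun t => by
    obtain ⟨i, _, hi⟩ := Finset.exists_mem_eq_inf' (s := Finset.univ) Finset.univ_nonempty (fun i => t i)
    exact ⟨i, hi.symm⟩
  let A : Set (stdSimplex ℝ (Fin (n+1))) := {t | 2 * (n+1) * m t ≤ 1}
  let b : stdSimplex ℝ (Fin (n+1)) → stdSimplex ℝ (Fin (n+1)) := fun t =>
    if h : 2 * (n+1) * m t ≤ 1 then
      ⟨fun i => (t i - m t) / (1 - (n+1) * m t), fun i => 
        div_nonneg (by linarith [hml t i]) (by linarith), by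
          rw [← Finset.sum_div, Finset.sum_sub_distrib, stdSimplex.sum_eq_one]
          simp
          intro h'
          linarith⟩
    else t
  have hbA : ContinuousOn b A := by
    rw [continuousOn_iff_continuous_domRestrict]
    have : A.domRestrict b = fun t : A => 
      (⟨fun i => (t.1 i - m t.1) / (1 - (n+1) * m t.1), by
        have := (b t.1).2
        have h : 2 * (n+1) * m t.1 ≤ 1 := t.2
        simpa [b, h] using this⟩ : stdSimplex ℝ (Fin (n+1))) := by
      ext1 t
      have h : 2 * (n+1) * m t.1 ≤ 1 := t.2
      change b t.1 = _
      simp only [b, h, dif_pos]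
    rw [this]
    apply Continuous.subtype_mk
    apply continuous_pi
    intro i
    have h1 : Continuous (fun t : A => m t.1) := hmc.comp continuous_subtype_val
    apply Continuous.div
    · exact ((continuous_apply i).comp (continuous_subtype_val.comp continuous_subtype_val)).sub h1
    · fun_prop
    · intro t
      have h : 2 * (n+1) * m t.1 ≤ 1 := t.2
      nlinarith
  let G : stdSimplex ℝ (Fin (n+1)) → Z := fun t =>
    if 1 ≤ 2 * (n+1) * m t then z0 else H (Set.projIcc 0 1 zero_le_one (2 * (n+1) * m t), F (b t))
  let K : Option (Fin (n+1)) → Set (stdSimplex ℝ (Fin (n+1))) := fun o => match o with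
    | none => {t | 1 ≤ 2 * (n+1) * m t}
    | some i => {t | t i = m t ∧ 2 * (n+1) * m t ≤ 1}
  have hti : ∀ i, Continuous (fun t : stdSimplex ℝ (Fin (n+1)) => t i) := fun i =>
    (continuous_apply i).comp continuous_subtype_val
  have hG : Continuous G := by
    apply LocallyFinite.continuous (f := K)
    · exact locallyFinite_of_finite K
    · ext t
      simp only [Set.mem_iUnion, Set.mem_univ, iff_true]
      by_cases h : 1 ≤ 2 * (n+1) * m t
      · exact ⟨none, h⟩
      · obtain ⟨i, hi⟩ := hex t
        exact ⟨some i, hi, by linarith⟩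
    · rintro (_ | i)
      · exact isClosed_le continuous_const (by fun_prop)
      · exact (isClosed_eq (hti i) hmc).inter (isClosed_le (f := fun t => 2 * (n+1) * m t) (g := fun _ => (1:ℝ)) (by fun_prop) continuous_const)
    · rintro (_ | i)
      · apply ContinuousOn.congr (f := fun _ => z0) continuousOn_const
        intro t ht
        have : 1 ≤ 2 * (n+1) * m t := ht
        simp [G, this]
      · have : ContinuousOn (fun t => H (Set.projIcc 0 1 zero_le_one (2 * (n+1) * m t), F (b t))) (K (some i)) := by
          apply H.continuous.comp_continuousOn
          apply ContinuousOn.prodMk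
          · apply Continuous.continuousOn
            exact continuous_projIcc.comp (by fun_prop)
          · apply (hFc i).comp
            · exact hbA.mono (fun t ht => ht.2)
            · intro t ht
              have h2 : 2 * (n+1) * m t ≤ 1 := ht.2
              change (b t) i = 0
              simp only [b, h2, dif_pos]
              change (t i - m t) / _ = 0
              rw [ht.1]; simp
        apply this.congr
        intro t ht
        by_cases h : 1 ≤ 2 * (n+1) * m t
        · simp only [G, h, if_true]
          rw [Set.projIcc_of_right_le _ h]
          exact (H.apply_one _).symm
        · simp only [G, h, if_false]
  refine ⟨⟨G, hG⟩, ?_⟩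
  intro k θ hθ t
  rw [← hF k θ hθ t]
  have h0 : ∃ i, stdSimplex.map θ t i = 0 := by
    by_contra hc
    push Not at hc
    exact hθ fun i => map_ne_zero' θ t i (hc i)
  have hm : m (stdSimplex.map θ t) = 0 := by
    obtain ⟨i, hi⟩ := h0
    exact le_antisymm (hi ▸ hml _ i) (hm0 _)
  have hb : b (stdSimplex.map θ t) = stdSimplex.map θ t := by
    ext i
    simp [b, hm]
    rfl
  change G _ = _
  simp only [G, hm, hb]
  simp
end fill
end WFN
end partT1

section partT2

open CategoryTheory Opposite

namespace WFN

/-- concrete boundary data -/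
def NS {n : ℕ} {m : SimplexCategoryᵒᵖ} (θ : op (SimplexCategory.mk n) ⟶ m) : Prop :=
  ¬ Function.Surjective θ.unop.toOrderHom

lemma NS.comp {n : ℕ} {m m' : SimplexCategoryᵒᵖ} {θ : op (SimplexCategory.mk n) ⟶ m}
    (h : NS θ) (ρ : m ⟶ m') : NS (θ ≫ ρ) := by
  intro h'
  exact h (Function.Surjective.of_comp h')

structure Bd (X : SSet.{0}) (n : ℕ) where
  φ : ∀ (m : SimplexCategoryᵒᵖ) (θ : op (SimplexCategory.mk n) ⟶ m), NS θ → X.obj m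
  nat : ∀ (m m' : SimplexCategoryᵒᵖ) (θ : op (SimplexCategory.mk n) ⟶ m) (h : NS θ) (ρ : m ⟶ m'),
    X.map ρ (φ m θ h) = φ m' (θ ≫ ρ) (h.comp ρ)

def TF (X : SSet.{0}) : Prop := ∀ (n : ℕ) (d : Bd X n), ∃ τ : X.obj (op (SimplexCategory.mk n)),
  ∀ m θ h, X.map θ τ = d.φ m θ h

lemma tf_sing (Z : TopCat.{0}) [ContractibleSpace Z] : TF (TopCat.toSSet.obj Z) := by
  intro n d
  obtain ⟨G, hG⟩ := fill_exists (Z := Z) (n := n)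
    (fun k θ h => TopCat.toSSetObjEquiv Z (op (SimplexCategory.mk k)) (d.φ (op (SimplexCategory.mk k)) (SimplexCategory.mkHom θ).op h)) 
    (by
      intro k k' θ θ' h h' t
      have := d.nat (op (SimplexCategory.mk k)) (op (SimplexCategory.mk k')) 
        (SimplexCategory.mkHom θ).op h (SimplexCategory.mkHom θ').op
      have h2 := congrArg (fun x => TopCat.toSSetObjEquiv Z (op (SimplexCategory.mk k')) x t) this
      exact h2.symm)
  refine ⟨(TopCat.toSSetObjEquiv Z (op (SimplexCategory.mk n))).symm G, ?_⟩
  intro m θ h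
  apply (TopCat.toSSetObjEquiv Z m).injective
  ext t
  have e1 : TopCat.toSSetObjEquiv Z m ((TopCat.toSSet.obj Z).map θ 
    ((TopCat.toSSetObjEquiv Z (op (SimplexCategory.mk n))).symm G)) t =
    TopCat.toSSetObjEquiv Z _ ((TopCat.toSSetObjEquiv Z (op (SimplexCategory.mk n))).symm G) 
      (stdSimplex.map θ.unop.toOrderHom t) := rfl
  rw [e1, Equiv.apply_symm_apply]
  exact hG m.unop.len θ.unop.toOrderHom h t

lemma mem_rlp {T S : SSet.{0}} (p : T ⟶ S)
    (H : ∀ (n : ℕ) (σ : S.obj (op (SimplexCategory.mk n))) (d : Bd T n),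
      (∀ m θ h, p.app m (d.φ m θ h) = S.map θ σ) →
      ∃ τ : T.obj (op (SimplexCategory.mk n)), p.app _ τ = σ ∧ ∀ m θ h, T.map θ τ = d.φ m θ h) :
    (MorphismProperty.monomorphisms SSet.{0}).rlp p := by
  rw [SSet.rlp_monomorphisms]
  rintro _ _ _ ⟨n⟩
  constructor
  intro f g sq
  have hsq : ∀ m (x : (SSet.boundary n).toSSet.obj m), p.app m (f.app m x) = g.app m x.1 := by
    intro m x
    have := congrArg (fun (q : _ ⟶ S) => q.app m x) sq.w
    exact this
  have hσ : ∀ (m : SimplexCategoryᵒᵖ) (θ : op (SimplexCategory.mk n) ⟶ m),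
      g.app m (SSet.stdSimplex.objEquiv.symm θ.unop) = S.map θ (SSet.yonedaEquiv g) := by
    intro m θ
    obtain ⟨σ, rfl⟩ := SSet.yonedaEquiv.symm.surjective g
    rw [Equiv.apply_symm_apply]
    rfl
  let d : Bd T n := 
    { φ := fun m θ h => f.app m ⟨SSet.stdSimplex.objEquiv.symm θ.unop, h⟩
      nat := fun m m' θ h ρ => by
        have := f.naturality ρ
        have h2 := congrArg (fun q => q ⟨SSet.stdSimplex.objEquiv.symm θ.unop, h⟩) this
        exact h2.symm }
  obtain ⟨τ, h1, h2⟩ := H n (SSet.yonedaEquiv g) d (by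
    intro m θ h
    rw [← hσ m θ]
    exact hsq m ⟨SSet.stdSimplex.objEquiv.symm θ.unop, h⟩)
  refine ⟨⟨⟨SSet.yonedaEquiv.symm τ, ?_, ?_⟩⟩⟩
  · ext m ⟨x, hx⟩
    obtain ⟨θ, rfl⟩ := SSet.stdSimplex.objEquiv.symm.surjective x
    exact h2 m θ.op hx
  · apply SSet.yonedaEquiv.injective
    rw [← h1]
    refine (SSet.yonedaEquiv_comp _ _).trans ?_
    exact congrArg (fun x => p.app _ x) (Equiv.apply_symm_apply SSet.yonedaEquiv τ)

lemma smap_id (S : SSet.{0}) {n : SimplexCategoryᵒᵖ} (x : S.obj n) : S.map (𝟙 n) x = x := by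
  simp

lemma smap_comp (S : SSet.{0}) {n m k : SimplexCategoryᵒᵖ} (f : n ⟶ m) (g : m ⟶ k) (x : S.obj n) :
    S.map (f ≫ g) x = S.map g (S.map f x) := by
  simp

section carrier
variable {S X : SSet.{0}} (C : ∀ ⦃n : SimplexCategoryᵒᵖ⦄, S.obj n → X.Subcomplex)

def carT : SSet.{0} where
  obj n := {p : S.obj n × X.obj n // ∀ m (f : n ⟶ m), X.map f p.2 ∈ (C (S.map f p.1)).obj m}
  map {n n'} g := TypeCat.ofHom fun p => ⟨(S.map g p.1.1, X.map g p.1.2), by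
    intro m f
    have := p.2 m (g ≫ f)
    simpa using this⟩
  map_id n := by
    apply ConcreteCategory.hom_ext
    intro x
    exact Subtype.ext (Prod.ext (smap_id S _) (smap_id X _))
  map_comp f g := by
    apply ConcreteCategory.hom_ext
    intro x
    exact Subtype.ext (Prod.ext (smap_comp S f g _) (smap_comp X f g _))

def carP : carT C ⟶ S where
  app _ := TypeCat.ofHom fun p => p.1.1
  naturality _ _ _ := rfl

def carQ : carT C ⟶ X where
  app _ := TypeCat.ofHom fun p => p.1.2
  naturality _ _ _ := rfl

variable (hC : ∀ {m n : SimplexCategoryᵒᵖ} (f : m ⟶ n) (σ : S.obj m), C (S.map f σ) ≤ C σ)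
  (hTF : ∀ (n : SimplexCategoryᵒᵖ) (σ : S.obj n), TF (C σ).toSSet)

include hC hTF in
lemma carP_rlp : (MorphismProperty.monomorphisms SSet.{0}).rlp (carP C) := by
  apply mem_rlp
  intro n σ d hd
  have hd' : ∀ m θ h, (d.φ m θ h).1.1 = S.map θ σ := hd
  let d' : Bd (C σ).toSSet n := 
    { φ := fun m θ h => ⟨(d.φ m θ h).1.2, by
        have := (d.φ m θ h).2 m (𝟙 m)
        rw [smap_id, smap_id, hd'] at this
        exact hC θ σ m this⟩
      nat := fun m m' θ h ρ => by
        have := d.nat m m' θ h ρ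
        apply Subtype.ext
        exact congrArg (fun x => x.1.2) this }
  obtain ⟨τ, hτ⟩ := hTF _ σ n d'
  have hτ' : ∀ m θ h, X.map θ τ.1 = (d.φ m θ h).1.2 := fun m θ h => 
    congrArg Subtype.val (hτ m θ h)
  have hmem : ∀ m (f : op (SimplexCategory.mk n) ⟶ m), X.map f τ.1 ∈ (C (S.map f σ)).obj m := by
    intro m θ
    by_cases h : NS θ
    · rw [hτ' m θ h, ← hd' m θ h]
      have := (d.φ m θ h).2 m (𝟙 m)
      rw [smap_id, smap_id] at this
      exact this
    · have hs : Function.Surjective θ.unop.toOrderHom := not_not.1 h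
      have : Epi θ.unop := SimplexCategory.epi_iff_surjective.2 hs
      have : IsSplitEpi θ.unop := isSplitEpi_of_epi θ.unop
      have hsec : θ ≫ (section_ θ.unop).op = 𝟙 _ := by
        apply Quiver.Hom.unop_inj
        simp
      have h1 := hC (section_ θ.unop).op (S.map θ σ)
      rw [← smap_comp, hsec, smap_id] at h1
      exact h1 m ((C σ).map θ τ.2)
  refine ⟨⟨(σ, τ.1), hmem⟩, rfl, ?_⟩
  intro m θ h
  exact Subtype.ext (Prod.ext (hd' m θ h).symm (hτ' m θ h))

include hC hTF in
theorem carrier (A : S.Subcomplex) (f : A.toSSet ⟶ X) 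
    (hf : ∀ n (a : A.toSSet.obj n), f.app n a ∈ (C a.1).obj n) :
    ∃ F : S ⟶ X, A.ι ≫ F = f ∧ ∀ n (σ : S.obj n), F.app n σ ∈ (C σ).obj n := by
  let u : A.toSSet ⟶ carT C := 
    { app := fun n => TypeCat.ofHom fun a => ⟨(a.1, f.app n a), by
        intro m g
        have h1 := hf m (A.toSSet.map g a)
        have h2 : f.app m (A.toSSet.map g a) = X.map g (f.app n a) := by
          exact congrArg (fun q => q a) (f.naturality g)
        rw [h2] at h1
        exact h1⟩
      naturality := by
        intro n m g
        apply ConcreteCategory.hom_ext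
        intro a
        apply Subtype.ext
        refine Prod.ext rfl ?_
        exact congrArg (fun q => q a) (f.naturality g) }
  have hl := carP_rlp C hC hTF A.ι (by exact inferInstanceAs (Mono A.ι))
  have sq : CommSq u A.ι (carP C) (𝟙 S) := ⟨rfl⟩
  obtain ⟨⟨l⟩⟩ := hl.sq_hasLift sq
  refine ⟨l.l ≫ carQ C, ?_, ?_⟩
  · rw [← Category.assoc, l.fac_left]
    rfl
  · intro n σ
    have h1 : (l.l.app n σ).1.1 = σ := 
      congrArg (fun (q : S ⟶ S) => q.app n σ) l.fac_right
    have := (l.l.app n σ).2 n (𝟙 n)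
    rw [smap_id, smap_id, h1] at this
    exact this

end carrier

end WFN
end partT2

section partT3

open CategoryTheory Opposite

namespace WFN

lemma ext_of_TF {A B X : SSet.{0}} (i : A ⟶ B) [Mono i] (hX : TF X) (f : A ⟶ X) :
    ∃ F : B ⟶ X, i ≫ F = f := by
  let pt : SSet.{0} := (Functor.const _).obj PUnit
  let p : ∀ Y : SSet.{0}, Y ⟶ pt := fun Y => { app := fun _ => TypeCat.ofHom fun _ => PUnit.unit }
  have h1 : (MorphismProperty.monomorphisms SSet.{0}).rlp (p X) := by
    apply mem_rlp
    intro n σ d _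
    obtain ⟨τ, hτ⟩ := hX n d
    exact ⟨τ, rfl, hτ⟩
  have hl := h1 i (by exact inferInstanceAs (Mono i))
  have sq : CommSq f i (p X) (p B) := ⟨rfl⟩
  obtain ⟨⟨l⟩⟩ := hl.sq_hasLift sq
  exact ⟨l.l, l.fac_left⟩

/-- the two point indiscrete space -/
inductive Ind : Type
  | a : Ind
  | b : Ind

instance : TopologicalSpace Ind := ⊤

lemma ind_cont {Y : Type} [TopologicalSpace Y] (f : Y → Ind) : Continuous f := continuous_top

instance : ContractibleSpace Ind := by
  rw [contractible_iff_id_nullhomotopic]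
  classical
  refine ⟨Ind.a, ⟨?_⟩⟩
  exact { toFun := fun p => if p.1 = 0 then p.2 else Ind.a
          continuous_toFun := ind_cont _
          map_zero_left := by intro x; simp
          map_one_left := by intro x; simp }

lemma toTop_inj {A B : SSet.{0}} (i : A ⟶ B) [Mono i] : 
    Function.Injective (SSet.toTop.map i) := by
  classical
  intro x y hxy
  by_contra hne
  let Z : TopCat.{0} := TopCat.of Ind
  have hZ : ContractibleSpace Z := inferInstanceAs (ContractibleSpace Ind)
  let f : SSet.toTop.obj A ⟶ Z := TopCat.ofHom ⟨fun z => if z = x then Ind.a else Ind.b, ind_cont _⟩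
  obtain ⟨F, hF⟩ := ext_of_TF i (tf_sing Z) (sSetTopAdj.homEquiv _ _ f)
  have h2 : SSet.toTop.map i ≫ (sSetTopAdj.homEquiv _ _).symm F = f := by
    rw [← Adjunction.homEquiv_naturality_left_symm, hF, Equiv.symm_apply_apply]
  have hx : f x = (sSetTopAdj.homEquiv _ _).symm F (SSet.toTop.map i x) := by
    rw [← h2]; rfl
  have hy : f y = (sSetTopAdj.homEquiv _ _).symm F (SSet.toTop.map i y) := by
    rw [← h2]; rfl
  have : f x = f y := by rw [hx, hy, hxy]
  have h3 : (if x = x then Ind.a else Ind.b) = (if y = x then Ind.a else Ind.b) := this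
  rw [if_pos rfl, if_neg (Ne.symm hne)] at h3
  cases h3

lemma tf_range {A X : SSet.{0}} (i : A ⟶ X) (hi : ∀ n, Function.Injective (i.app n)) (hA : TF A) : 
    TF (SSet.Subcomplex.range i).toSSet := by
  intro n d
  have hch : ∀ m θ h, ∃ a : A.obj m, i.app m a = (d.φ m θ h).1 := fun m θ h => (d.φ m θ h).2
  choose φ hφ using hch
  let d' : Bd A n := ⟨φ, fun m m' θ h ρ => by
    apply hi
    rw [hφ]
    have h1 : i.app m' (A.map ρ (φ m θ h)) = X.map ρ (i.app m (φ m θ h)) := 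
      congrArg (fun q => q (φ m θ h)) (i.naturality ρ)
    rw [h1, hφ]
    exact congrArg Subtype.val (d.nat m m' θ h ρ)⟩
  obtain ⟨τ, hτ⟩ := hA n d'
  refine ⟨⟨i.app _ τ, ⟨τ, rfl⟩⟩, ?_⟩
  intro m θ h
  apply Subtype.ext
  rw [← hφ]
  refine Eq.trans ?_ (congrArg (fun a => i.app m a) (hτ m θ h))
  exact (congrArg (fun q => q τ) (i.naturality θ)).symm

noncomputable def rl {S : SSet.{0}} {Z : TopCat.{0}} (f : S ⟶ TopCat.toSSet.obj Z) : SSet.toTop.obj S ⟶ Z := 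
  (sSetTopAdj.homEquiv S Z).symm f

lemma rl_comp {S : SSet.{0}} {Z Z' : TopCat.{0}} (f : S ⟶ TopCat.toSSet.obj Z) (z : Z ⟶ Z') :
    rl f ≫ z = rl (f ≫ TopCat.toSSet.map z) := by
  simp [rl, Adjunction.homEquiv_naturality_right_symm]

lemma comp_rl {S S' : SSet.{0}} {Z : TopCat.{0}} (u : S' ⟶ S) (f : S ⟶ TopCat.toSSet.obj Z) :
    SSet.toTop.map u ≫ rl f = rl (u ≫ f) := by
  simp [rl, Adjunction.homEquiv_naturality_left_symm]

lemma rl_unit (S : SSet.{0}) : rl (sSetTopAdj.unit.app S) = 𝟙 _ := by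
  simp [rl]
  
/-- left inclusion into the join -/
def jl (n : ℕ) : Fin (n+1) →o Fin (n+1+n+1) := 
  ⟨fun i => ⟨i, by omega⟩, fun a b h => by simpa using h⟩
def jr (n : ℕ) : Fin (n+1) →o Fin (n+1+n+1) := 
  ⟨fun i => ⟨n+1+i, by omega⟩, fun a b h => by simpa using h⟩
lemma jl_val {n : ℕ} (i : Fin (n+1)) : (jl n i).1 = i := rfl
lemma jr_val {n : ℕ} (i : Fin (n+1)) : (jr n i).1 = n + 1 + i := rfl
def jj {m n : ℕ} (θ : Fin (m+1) →o Fin (n+1)) : Fin (m+1+m+1) →o Fin (n+1+n+1) :=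
  ⟨fun i => if h : i.1 < m+1 then jl n (θ ⟨i, h⟩) else jr n (θ ⟨i - (m+1), by omega⟩), by
    intro a b hab
    have hab' : a.1 ≤ b.1 := hab
    dsimp only
    split_ifs with h1 h2
    · exact (jl n).monotone (θ.monotone hab)
    · rw [Fin.le_def, jl_val, jr_val]; omega
    · omega
    · exact (jr n).monotone (θ.monotone (by simp only [Fin.mk_le_mk]; omega))⟩

lemma jj_jl {m n : ℕ} (θ : Fin (m+1) →o Fin (n+1)) (i) : jj θ (jl m i) = jl n (θ i) := by
  change (if h : i.1 < m+1 then jl n (θ ⟨i, h⟩) else jr n (θ ⟨i - (m+1), by omega⟩)) = _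
  rw [dif_pos i.2]
lemma jj_jr {m n : ℕ} (θ : Fin (m+1) →o Fin (n+1)) (i) : jj θ (jr m i) = jr n (θ i) := by
  have : ¬ (m+1+i.1 < m+1) := by omega
  change (if h : m+1+i.1 < m+1 then jl n (θ ⟨m+1+i, h⟩) else jr n (θ ⟨m+1+i - (m+1), by omega⟩)) = _
  rw [dif_neg this]
  congr 2
  ext
  simp

noncomputable def mix {n : ℕ} (t t' : stdSimplex ℝ (Fin n)) (s : unitInterval) : stdSimplex ℝ (Fin n) :=
  ⟨(1 - s.1) • t.1 + s.1 • t'.1, convex_stdSimplex ℝ _ t.2 t'.2 (by linarith [s.2.2]) s.2.1 (by ring)⟩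

lemma mix_zero {n : ℕ} (t t' : stdSimplex ℝ (Fin n)) : mix t t' 0 = t := by
  apply Subtype.ext; simp [mix]
lemma mix_one {n : ℕ} (t t' : stdSimplex ℝ (Fin n)) : mix t t' 1 = t' := by
  apply Subtype.ext; simp [mix]
lemma map_mix {n m : ℕ} (f : Fin n → Fin m) (t t' : stdSimplex ℝ (Fin n)) (s : unitInterval) : 
    stdSimplex.map f (mix t t' s) = mix (stdSimplex.map f t) (stdSimplex.map f t') s := by
  apply Subtype.ext
  change (stdSimplex.map f (mix t t' s) : Fin m → ℝ) = 
    (1 - s.1) • (stdSimplex.map f t : Fin m → ℝ) + s.1 • (stdSimplex.map f t' : Fin m → ℝ)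
  rw [stdSimplex.map_coe, stdSimplex.map_coe, stdSimplex.map_coe]
  change FunOnFinite.linearMap ℝ ℝ f ((1 - s.1) • t.1 + s.1 • t'.1) = _
  rw [map_add, map_smul, map_smul]
  rfl

noncomputable def jmap (n : ℕ) : C(stdSimplex ℝ (Fin (n+1)) × unitInterval, stdSimplex ℝ (Fin (n+1+n+1))) where
  toFun p := mix (stdSimplex.map (jl n) p.1) (stdSimplex.map (jr n) p.1) p.2
  continuous_toFun := by
    apply Continuous.subtype_mk
    have h1 : Continuous (fun p : stdSimplex ℝ (Fin (n+1)) × unitInterval => (stdSimplex.map (jl n) p.1).1) :=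
      continuous_subtype_val.comp ((stdSimplex.continuous_map _).comp continuous_fst)
    have h2 : Continuous (fun p : stdSimplex ℝ (Fin (n+1)) × unitInterval => (stdSimplex.map (jr n) p.1).1) :=
      continuous_subtype_val.comp ((stdSimplex.continuous_map _).comp continuous_fst)
    fun_prop

lemma jmap_nat {m n : ℕ} (θ : Fin (m+1) →o Fin (n+1)) (t s) : 
    stdSimplex.map (jj θ) (jmap m (t, s)) = jmap n (stdSimplex.map θ t, s) := by
  change stdSimplex.map (jj θ) (mix _ _ s) = mix _ _ s
  rw [map_mix, stdSimplex.map_comp_apply, stdSimplex.map_comp_apply, stdSimplex.map_comp_apply, 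
    stdSimplex.map_comp_apply]
  congr 2
  · ext i : 1; exact jj_jl θ i
  · ext i : 1; exact jj_jr θ i

theorem join_homotopy {S : SSet.{0}} {Z : TopCat.{0}} 
    (h : ∀ n : SimplexCategoryᵒᵖ, S.obj n → 
      (TopCat.toSSet.obj Z).obj (op (SimplexCategory.mk (n.unop.len+1+n.unop.len))))
    (hn : ∀ {n m : SimplexCategoryᵒᵖ} (θ : n ⟶ m) (σ : S.obj n), 
      (TopCat.toSSet.obj Z).map (SimplexCategory.mkHom (jj θ.unop.toOrderHom)).op (h n σ) = h m (S.map θ σ))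
    (f0 f1 : S ⟶ TopCat.toSSet.obj Z)
    (h0 : ∀ n σ, f0.app n σ = (TopCat.toSSet.obj Z).map (Y := n) (SimplexCategory.mkHom (jl n.unop.len)).op (h n σ))
    (h1 : ∀ n σ, f1.app n σ = (TopCat.toSSet.obj Z).map (Y := n) (SimplexCategory.mkHom (jr n.unop.len)).op (h n σ)) :
    ContinuousMap.Homotopic (rl f0).hom (rl f1).hom := by
  let Y : TopCat.{0} := TopCat.of C(unitInterval, Z)
  let g : S ⟶ TopCat.toSSet.obj Y := 
    { app := fun n => TypeCat.ofHom fun σ => (TopCat.toSSetObjEquiv Y n).symm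
        (ContinuousMap.curry ((TopCat.toSSetObjEquiv Z _ (h n σ)).comp (jmap n.unop.len)))
      naturality := by
        intro n m θ
        apply ConcreteCategory.hom_ext
        intro σ
        apply (TopCat.toSSetObjEquiv Y m).injective
        refine (Equiv.apply_symm_apply _ _).trans ?_
        ext t s
        have e2 : TopCat.toSSetObjEquiv Y m ((TopCat.toSSet.obj Y).map θ ((TopCat.toSSetObjEquiv Y n).symm
          (ContinuousMap.curry ((TopCat.toSSetObjEquiv Z _ (h n σ)).comp (jmap n.unop.len))))) t = 
          TopCat.toSSetObjEquiv Y n ((TopCat.toSSetObjEquiv Y n).symm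
          (ContinuousMap.curry ((TopCat.toSSetObjEquiv Z _ (h n σ)).comp (jmap n.unop.len)))) 
            (stdSimplex.map θ.unop.toOrderHom t) := rfl
        refine Eq.trans ?_ (congrArg (fun (q : C(unitInterval, Z)) => q s) e2).symm
        rw [Equiv.apply_symm_apply]
        change TopCat.toSSetObjEquiv Z _ (h m (S.map θ σ)) (jmap m.unop.len (t, s)) = 
          TopCat.toSSetObjEquiv Z _ (h n σ) (jmap n.unop.len (stdSimplex.map θ.unop.toOrderHom t, s))
        rw [← hn θ σ, ← jmap_nat]
        rfl }
  let G : C(SSet.toTop.obj S, C(unitInterval, Z)) := (rl g).hom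
  have hev : ∀ s : unitInterval, ∃ e : Y ⟶ Z, ∀ q : C(unitInterval, Z), e q = q s := fun s => 
    ⟨TopCat.ofHom ⟨fun q : C(unitInterval, Z) => q s, continuous_eval_const s⟩, fun q => rfl⟩
  have hend : ∀ (s : unitInterval) (f : S ⟶ TopCat.toSSet.obj Z), (∀ n σ t, 
      TopCat.toSSetObjEquiv Z n (f.app n σ) t = TopCat.toSSetObjEquiv Z _ (h n σ) (jmap n.unop.len (t, s))) →
      ∀ x, G x s = rl f x := by
    intro s f hf x
    obtain ⟨e, he⟩ := hev s
    rw [← he]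
    have : rl g ≫ e = rl f := by
      rw [rl_comp]
      congr 1
      ext n σ
      apply (TopCat.toSSetObjEquiv Z n).injective
      ext t
      refine Eq.trans ?_ (hf n σ t).symm
      refine (he (TopCat.toSSetObjEquiv Y n (g.app n σ) t)).trans ?_
      have := Equiv.apply_symm_apply (TopCat.toSSetObjEquiv Y n) (ContinuousMap.curry ((TopCat.toSSetObjEquiv Z _ (h n σ)).comp (jmap n.unop.len)))
      exact congrArg (fun (q : C(stdSimplex ℝ (Fin (n.unop.len+1)), C(unitInterval, Z))) => q t s) this
    rw [← this]
    rfl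
  refine ⟨⟨⟨fun p => G p.2 p.1, ?_⟩, ?_, ?_⟩⟩
  · have := ContinuousMap.continuous_uncurry_of_continuous G
    exact this.comp continuous_swap
  · intro x
    refine hend 0 f0 ?_ x
    intro n σ t
    rw [h0]
    change TopCat.toSSetObjEquiv Z _ (h n σ) (stdSimplex.map (jl n.unop.len) t) = 
      TopCat.toSSetObjEquiv Z _ (h n σ) (mix _ _ 0)
    rw [mix_zero]
  · intro x
    refine hend 1 f1 ?_ x
    intro n σ t
    rw [h1]
    change TopCat.toSSetObjEquiv Z _ (h n σ) (stdSimplex.map (jr n.unop.len) t) = 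
      TopCat.toSSetObjEquiv Z _ (h n σ) (mix _ _ 1)
    rw [mix_one]

end WFN
end partT3

section partT4

open CategoryTheory Opposite

namespace WFN

def Good (P : Type) [Preorder P] : Prop := ContractibleSpace (SSet.toTop.obj (nerve P))

section
variable {P Q : Type} [Preorder P] [Preorder Q]

lemma nerve_ext {n : SimplexCategoryᵒᵖ} {σ τ : (nerve P).obj n} 
    (h : ∀ i : Fin (n.unop.len+1), σ.obj i = τ.obj i) : σ = τ :=
  CategoryTheory.Functor.ext h (fun _ _ _ => Subsingleton.elim _ _)

def mkN {n : SimplexCategoryᵒᵖ} (f : Fin (n.unop.len+1) → P) (hf : Monotone f) : (nerve P).obj n :=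
  hf.functor

lemma nv_mono {n : SimplexCategoryᵒᵖ} (σ : (nerve P).obj n) : 
    Monotone (fun i : Fin (n.unop.len+1) => (σ.obj i : P)) :=
  fun _ _ h => leOfHom (σ.map (homOfLE h))

lemma nv_map {n m : SimplexCategoryᵒᵖ} (θ : n ⟶ m) (σ : (nerve P).obj n) (i : Fin (m.unop.len+1)) : 
   (((nerve P).map θ σ : (nerve P).obj m).obj i : P) = σ.obj (θ.unop.toOrderHom i) := rfl

/-- nerve of a monotone map -/
def nm (f : P → Q) (hf : Monotone f) : nerve P ⟶ nerve Q := nerveMap hf.functor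

lemma nm_app {f : P → Q} {hf : Monotone f} {n : SimplexCategoryᵒᵖ} (σ : (nerve P).obj n) 
    (i : Fin (n.unop.len+1)) : 
    (((nm f hf).app n σ : (nerve Q).obj n).obj i : Q) = f (σ.obj i) := rfl

/-- simplices of the cylinder -/
@[ext]
structure CylS (P : Type) [Preorder P] (n : ℕ) where
  x : Fin (n+1) → P
  e : Fin (n+1) → Bool
  he : Monotone e
  hx : ∀ i j, i ≤ j → e i = e j → x i ≤ x j
  hc : ∀ i j, x i ≤ x j ∨ x j ≤ x i

def Cyl (P : Type) [Preorder P] : SSet.{0} where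
  obj n := CylS P n.unop.len
  map θ := TypeCat.ofHom fun c => 
    ⟨c.x ∘ θ.unop.toOrderHom, c.e ∘ θ.unop.toOrderHom, c.he.comp θ.unop.toOrderHom.monotone, 
      fun i j h h' => c.hx _ _ (θ.unop.toOrderHom.monotone h) h', fun i j => c.hc _ _⟩
  map_id _ := rfl
  map_comp _ _ := rfl

def CylEnds (P : Type) [Preorder P] : (Cyl P).Subcomplex where
  obj n := {c : CylS P n.unop.len | ∀ i, c.e i = c.e 0}
  map θ c hc := by
    intro i
    have h := hc
    exact (h _).trans (h _).symm

lemma cyl_min {k : ℕ} (c : CylS P k) : ∃ i, ∀ j, c.x i ≤ c.x j := by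
  obtain ⟨i, hi⟩ := Finset.exists_minimalFor c.x Finset.univ Finset.univ_nonempty
  refine ⟨i, fun j => ?_⟩
  rcases c.hc i j with h | h
  · exact h
  · exact hi.2 (Finset.mem_univ j) h

/-- fold map of the join -/
def fd (n : ℕ) (k : Fin (n+1+n+1)) : Fin (n+1) :=
  if h : k.1 < n+1 then ⟨k.1, h⟩ else ⟨k.1 - (n+1), by omega⟩

lemma fd_jl (n : ℕ) (i : Fin (n+1)) : fd n (jl n i) = i := by
  have : (jl n i).1 < n+1 := i.2
  simp only [fd, this, dif_pos]
  rfl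

lemma fd_jr (n : ℕ) (i : Fin (n+1)) : fd n (jr n i) = i := by
  have : ¬ (jr n i).1 < n+1 := by rw [jr_val]; omega
  simp only [fd, this, dif_neg, not_false_eq_true]
  ext
  simp [jr_val]

lemma lr_cases {n : ℕ} (k : Fin (n+1+n+1)) : (∃ i, k = jl n i) ∨ (∃ i, k = jr n i) := by
  by_cases h : k.1 < n+1
  · exact Or.inl ⟨⟨k.1, h⟩, rfl⟩
  · refine Or.inr ⟨⟨k.1 - (n+1), by omega⟩, ?_⟩
    ext
    rw [jr_val]
    simp only
    omega

lemma fd_jj {m n : ℕ} (θ : Fin (m+1) →o Fin (n+1)) (k) : fd n (jj θ k) = θ (fd m k) := by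
  rcases lr_cases k with ⟨i, rfl⟩ | ⟨i, rfl⟩
  · rw [jj_jl, fd_jl, fd_jl]
  · rw [jj_jr, fd_jr, fd_jr]

lemma ej_jj {m n : ℕ} (θ : Fin (m+1) →o Fin (n+1)) (k) : 
    decide (n + 1 ≤ (jj θ k).1) = decide (m + 1 ≤ k.1) := by
  rcases lr_cases k with ⟨i, rfl⟩ | ⟨i, rfl⟩
  · rw [jj_jl, jl_val, jl_val, decide_eq_decide]; omega
  · rw [jj_jr, jr_val, jr_val, decide_eq_decide]; omega

def dd {n : SimplexCategoryᵒᵖ} (σ : (nerve P).obj n) : CylS P (n.unop.len+1+n.unop.len) where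
  x k := σ.obj (fd n.unop.len k)
  e k := decide (n.unop.len + 1 ≤ k.1)
  he := by
    intro a b hab
    have : a.1 ≤ b.1 := hab
    by_cases h : n.unop.len + 1 ≤ a.1
    · have h2 : n.unop.len + 1 ≤ b.1 := h.trans this
      simp [h, h2]
    · simp [h]
  hx := by
    intro i j hij h
    have hij' : i.1 ≤ j.1 := hij
    apply nv_mono σ
    rw [decide_eq_decide] at h
    rw [fd, fd, Fin.le_def]
    split_ifs
    · simpa using hij'
    · omega
    · omega
    · simp only; omega
  hc := by
    intro i j
    rcases le_total (fd n.unop.len i) (fd n.unop.len j) with h | h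
    · exact Or.inl (nv_mono σ h)
    · exact Or.inr (nv_mono σ h)

lemma cyl_homotopy {Z : TopCat.{0}} (C : P → (TopCat.toSSet.obj Z).Subcomplex)
    (anti : ∀ p p', p ≤ p' → C p' ≤ C p) (hTF : ∀ p, TF (C p).toSSet)
    (f0 f1 : nerve P ⟶ TopCat.toSSet.obj Z) 
    (h0 : ∀ n (σ : (nerve P).obj n), f0.app n σ ∈ (C (σ.obj (0 : Fin (n.unop.len+1)))).obj n)
    (h1 : ∀ n (σ : (nerve P).obj n), f1.app n σ ∈ (C (σ.obj (0 : Fin (n.unop.len+1)))).obj n) :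
    ContinuousMap.Homotopic (rl f0).hom (rl f1).hom := by
  classical
  let mn : ∀ {n : SimplexCategoryᵒᵖ} (c : (Cyl P).obj n), P := fun {n} c => 
    CylS.x c (Classical.choose (cyl_min c))
  have hmn : ∀ {n : SimplexCategoryᵒᵖ} (c : (Cyl P).obj n) i, mn c ≤ CylS.x c i := fun {n} c i => 
    Classical.choose_spec (cyl_min c) i
  let nn : ∀ {n : SimplexCategoryᵒᵖ} (c : (CylEnds P).toSSet.obj n), (nerve P).obj n := fun {n} c =>
    mkN (CylS.x c.1) (fun i j h => by
      have hc := c.2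
      exact CylS.hx c.1 i j h ((hc i).trans (hc j).symm))
  let f : (CylEnds P).toSSet ⟶ TopCat.toSSet.obj Z := 
    { app := fun n => TypeCat.ofHom fun c => 
        if CylS.e c.1 0 = true then f1.app n (nn c) else f0.app n (nn c)
      naturality := by
        intro n m θ
        apply ConcreteCategory.hom_ext
        intro c
        have hc := c.2
        have he : CylS.e ((CylEnds P).toSSet.map θ c).1 0 = CylS.e c.1 0 := hc _
        have e1 : f1.app m ((nerve P).map θ (nn c)) = (TopCat.toSSet.obj Z).map θ (f1.app n (nn c)) := 
          congrArg (fun q => q (nn c)) (f1.naturality θ)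
        have e0 : f0.app m ((nerve P).map θ (nn c)) = (TopCat.toSSet.obj Z).map θ (f0.app n (nn c)) := 
          congrArg (fun q => q (nn c)) (f0.naturality θ)
        change (if CylS.e ((CylEnds P).toSSet.map θ c).1 0 = true then f1.app m ((nerve P).map θ (nn c)) 
          else f0.app m ((nerve P).map θ (nn c))) = 
          (TopCat.toSSet.obj Z).map θ (if CylS.e c.1 0 = true then f1.app n (nn c) else f0.app n (nn c))
        rw [he]
        split_ifs
        · exact e1
        · exact e0 }
  obtain ⟨F, hF, -⟩ := carrier (S := Cyl P) (X := TopCat.toSSet.obj Z) (fun n c => C (mn c))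
    (by
      intro m n θ c
      apply anti
      exact hmn c _)
    (fun n c => hTF _) (CylEnds P) f (by
      intro n c
      change (if CylS.e c.1 0 = true then f1.app n (nn c) else f0.app n (nn c)) ∈ _
      have hle : C ((nn c).obj (0 : Fin (n.unop.len+1))) ≤ C (mn (n := n) c.1) := anti _ _ (hmn (n := n) c.1 0)
      split_ifs
      · exact hle n (h1 n (nn c))
      · exact hle n (h0 n (nn c)))
  have hF' : ∀ n (c : (CylEnds P).toSSet.obj n), F.app n c.1 = 
      if CylS.e c.1 0 = true then f1.app n (nn c) else f0.app n (nn c) := by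
    intro n c
    exact congrArg (fun (q : _ ⟶ TopCat.toSSet.obj Z) => q.app n c) hF
  apply join_homotopy (fun n σ => F.app (op (SimplexCategory.mk (n.unop.len+1+n.unop.len))) (dd σ))
  · intro n m θ σ
    refine (congrArg (fun q => q (dd σ)) 
      (F.naturality (SimplexCategory.mkHom (jj θ.unop.toOrderHom)).op)).symm.trans ?_
    apply congrArg (fun c => F.app (op (SimplexCategory.mk (m.unop.len+1+m.unop.len))) c)
    apply CylS.ext
    · funext k
      exact congrArg (fun i => (σ.obj i : P)) (fd_jj θ.unop.toOrderHom k)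
    · funext k
      exact ej_jj θ.unop.toOrderHom k
  · intro n σ
    refine Eq.trans ?_ (congrArg (fun q => q (dd σ)) 
      (F.naturality (Y := n) (SimplexCategory.mkHom (jl n.unop.len)).op))
    have hz : ∀ i, CylS.e ((Cyl P).map (Y := n) (SimplexCategory.mkHom (jl n.unop.len)).op (dd σ)) i = false := by
      intro i
      change decide (n.unop.len + 1 ≤ (jl n.unop.len i).1) = false
      rw [jl_val, decide_eq_false_iff_not]
      omega
    have := hF' n ⟨(Cyl P).map (Y := n) (SimplexCategory.mkHom (jl n.unop.len)).op (dd σ), 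
      fun i => (hz i).trans (hz 0).symm⟩
    refine Eq.trans ?_ (this.trans (if_neg (fun h => Bool.noConfusion ((hz 0).symm.trans h)))).symm
    apply congrArg (fun c => f0.app n c)
    apply nerve_ext
    intro i
    exact congrArg (fun i => (σ.obj i : P)) (fd_jl _ i).symm
  · intro n σ
    refine Eq.trans ?_ (congrArg (fun q => q (dd σ)) 
      (F.naturality (Y := n) (SimplexCategory.mkHom (jr n.unop.len)).op))
    have hz : ∀ i, CylS.e ((Cyl P).map (Y := n) (SimplexCategory.mkHom (jr n.unop.len)).op (dd σ)) i = true := by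
      intro i
      change decide (n.unop.len + 1 ≤ (jr n.unop.len i).1) = true
      rw [jr_val, decide_eq_true_iff]
      omega
    have := hF' n ⟨(Cyl P).map (Y := n) (SimplexCategory.mkHom (jr n.unop.len)).op (dd σ), 
      fun i => (hz i).trans (hz 0).symm⟩
    refine Eq.trans ?_ (this.trans (if_pos (hz 0))).symm
    apply congrArg (fun c => f1.app n c)
    apply nerve_ext
    intro i
    exact congrArg (fun i => (σ.obj i : P)) (fd_jr _ i).symm

end
end WFN
end partT4

section partT5

open CategoryTheory Opposite

namespace WFN
section
variable {P Q : Type} [Preorder P] [Preorder Q]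

noncomputable abbrev un (S : SSet.{0}) : S ⟶ TopCat.toSSet.obj (SSet.toTop.obj S) := sSetTopAdj.unit.app S

lemma nm_val_mono (D : Set P) : Mono (nm (Subtype.val : D → P) (Subtype.mono_coe _)) := by
  rw [NatTrans.mono_iff_mono_app]
  intro n
  rw [CategoryTheory.mono_iff_injective]
  intro σ τ h
  apply nerve_ext
  intro i
  apply Subtype.ext
  exact congrArg (fun q : (nerve P).obj n => (q.obj i : P)) h

noncomputable def subM (D : Set P) := 
  TopCat.toSSet.map (SSet.toTop.map (nm (Subtype.val : D → P) (Subtype.mono_coe _)))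

noncomputable def subC (D : Set P) : (TopCat.toSSet.obj (SSet.toTop.obj (nerve P))).Subcomplex :=
  SSet.Subcomplex.range (subM D)

lemma sing_inj {Z Z' : TopCat.{0}} (f : Z ⟶ Z') (hf : Function.Injective f) (n) : 
    Function.Injective ((TopCat.toSSet.map f).app n) := by
  intro σ τ h
  apply (TopCat.toSSetObjEquiv Z n).injective
  ext t
  apply hf
  exact congrArg (fun q => TopCat.toSSetObjEquiv Z' n q t) h

lemma subC_TF (D : Set P) (h : Good D) : TF (subC D).toSSet := by
  have := nm_val_mono D
  have h' : ContractibleSpace (SSet.toTop.obj (nerve D)) := h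
  exact tf_range _ (sing_inj _ (toTop_inj _)) (tf_sing _)

lemma subC_mono {D D' : Set P} (h : D ⊆ D') : subC D ≤ subC D' := by
  intro n x hx
  obtain ⟨y, rfl⟩ := hx
  have e : subM D = TopCat.toSSet.map (SSet.toTop.map (nm (Set.inclusion h) (fun a b hab => hab))) ≫ subM D' := by
    rw [subM, subM, ← Functor.map_comp, ← Functor.map_comp]
    rfl
  rw [e]
  exact ⟨_, rfl⟩

lemma mem_subC {D : Set P} {n : SimplexCategoryᵒᵖ} (σ : (nerve P).obj n) 
    (h : ∀ i : Fin (n.unop.len+1), (σ.obj i : P) ∈ D) : (un (nerve P)).app n σ ∈ (subC D).obj n := by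
  let σ' : (nerve D).obj n := mkN (fun i => ⟨σ.obj i, h i⟩) (fun i j hij => nv_mono σ hij)
  have e := sSetTopAdj.unit.naturality (nm (Subtype.val : D → P) (Subtype.mono_coe _))
  have e2 : (nm (Subtype.val : D → P) (Subtype.mono_coe _)).app n σ' = σ := nerve_ext (fun i => rfl)
  refine ⟨(un (nerve D)).app n σ', ?_⟩
  have e3 := congrArg (fun (q : nerve D ⟶ TopCat.toSSet.obj (SSet.toTop.obj (nerve P))) => q.app n σ') e
  refine e3.symm.trans ?_
  exact congrArg (fun s => (un (nerve P)).app n s) e2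

lemma rl_nm (f : P → Q) (hf : Monotone f) : rl (nm f hf ≫ un (nerve Q)) = SSet.toTop.map (nm f hf) := by
  rw [← comp_rl, rl_unit]
  exact Category.comp_id _

lemma good_of_factor {Y : TopCat.{0}} [ContractibleSpace Y] (f : SSet.toTop.obj (nerve P) ⟶ Y) (g : Y ⟶ SSet.toTop.obj (nerve P))
    (h : ContinuousMap.Homotopic (f ≫ g).hom (𝟙 (SSet.toTop.obj (nerve P)) : _ ⟶ _).hom) : Good P := by
  apply (contractible_iff_id_nullhomotopic _).2
  obtain ⟨y, hy⟩ := ((id_nullhomotopic Y).comp_left f.hom).comp_right g.hom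
  exact ⟨y, h.symm.trans hy⟩

lemma good_of_le_const (p0 : P) (h : ∀ p, p0 ≤ p) : Good P := by
  let Z := SSet.toTop.obj (nerve P)
  let x : ∀ (k : ℕ), (nerve P).obj (op (SimplexCategory.mk k)) := fun k => mkN (fun _ => p0) (fun _ _ _ => le_rfl)
  let cst : nerve P ⟶ nerve P := nm (fun _ => p0) (fun _ _ _ => le_rfl)
  let H : ∀ n : SimplexCategoryᵒᵖ, (nerve P).obj n → (nerve P).obj (op (SimplexCategory.mk (n.unop.len+1+n.unop.len))) := 
    fun n σ => mkN (n := (op (SimplexCategory.mk (n.unop.len+1+n.unop.len)))) 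
      (fun k => if n.unop.len + 1 ≤ k.1 then σ.obj (fd n.unop.len k) else p0) (by
        intro i j hij
        have hij' : i.1 ≤ j.1 := hij
        dsimp only
        split_ifs
        · apply nv_mono σ
          rw [fd, fd, Fin.le_def]
          split_ifs
          · omega
          · omega
          · omega
          · simp only; omega
        · omega
        · exact h _
        · exact le_rfl)
  have key : ContinuousMap.Homotopic (rl (cst ≫ un _)).hom (rl (un (nerve P))).hom := by
    apply join_homotopy (fun n σ => (un (nerve P)).app _ (H n σ))
    · intro n m θ σ
      refine (congrArg (fun q => q (H n σ)) 
        ((un (nerve P)).naturality (SimplexCategory.mkHom (jj θ.unop.toOrderHom)).op)).symm.trans ?_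
      apply congrArg (fun c => (un (nerve P)).app (op (SimplexCategory.mk (m.unop.len+1+m.unop.len))) c)
      apply nerve_ext
      intro k
      change (if n.unop.len + 1 ≤ (jj θ.unop.toOrderHom k).1 then (σ.obj (fd n.unop.len (jj θ.unop.toOrderHom k)) : P) else p0)
        = if m.unop.len + 1 ≤ k.1 then σ.obj (θ.unop.toOrderHom (fd m.unop.len k)) else p0
      rw [fd_jj]
      have := decide_eq_decide.1 (ej_jj θ.unop.toOrderHom k)
      simp only [this]
    · intro n σ
      refine Eq.trans ?_ (congrArg (fun q => q (H n σ)) 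
        ((un (nerve P)).naturality (Y := n) (SimplexCategory.mkHom (jl n.unop.len)).op))
      apply congrArg (fun c => (un (nerve P)).app n c)
      apply nerve_ext
      intro k
      refine (if_neg ?_).symm
      change ¬ (n.unop.len + 1 ≤ (jl n.unop.len k).1)
      rw [jl_val]; omega
    · intro n σ
      refine Eq.trans ?_ (congrArg (fun q => q (H n σ)) 
        ((un (nerve P)).naturality (Y := n) (SimplexCategory.mkHom (jr n.unop.len)).op))
      apply congrArg (fun c => (un (nerve P)).app n c)
      apply nerve_ext
      intro k
      have : n.unop.len + 1 ≤ (jr n.unop.len k).1 := by rw [jr_val]; omega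
      refine Eq.trans ?_ (if_pos this).symm
      exact congrArg (fun i => (σ.obj i : P)) (fd_jr _ k).symm
  rw [rl_unit] at key
  -- constant factors through a point
  let pt : nerve P ⟶ SSet.stdSimplex.obj (SimplexCategory.mk 0) := SSet.stdSimplex.isTerminalObj₀.from _
  let inc : SSet.stdSimplex.obj (SimplexCategory.mk 0) ⟶ nerve P := SSet.yonedaEquiv.symm (x 0)
  have e : cst = pt ≫ inc := by
    apply NatTrans.ext
    funext n
    apply ConcreteCategory.hom_ext
    intro σ
    apply nerve_ext
    intro i
    rfl
  have e2 : rl (cst ≫ un _) = SSet.toTop.map pt ≫ SSet.toTop.map inc := by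
    rw [← Functor.map_comp, ← e]
    exact rl_nm _ _
  rw [e2] at key
  have hc : ContractibleSpace (SSet.toTop.obj (SSet.stdSimplex.obj (SimplexCategory.mk 0))) := by
    have hh := TopCat.homeoOfIso (SSet.toTopSimplex.{0}.app (SimplexCategory.mk 0))
    have : Unique (SimplexCategory.toTop.{0}.obj (SimplexCategory.mk 0)) := 
      inferInstanceAs (Unique (ULift (stdSimplex ℝ (Fin 1))))
    have hu : Unique (SSet.toTop.obj (SSet.stdSimplex.obj (SimplexCategory.mk 0))) := 
      hh.toEquiv.unique
    infer_instance
  exact good_of_factor _ _ key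

lemma homotopic_of_le (f g : P → Q) (hf : Monotone f) (hg : Monotone g) (h : ∀ p, f p ≤ g p) :
    ContinuousMap.Homotopic (SSet.toTop.map (nm f hf)).hom (SSet.toTop.map (nm g hg)).hom := by
  rw [← rl_nm, ← rl_nm]
  apply cyl_homotopy (fun p => subC {q | f p ≤ q})
  · intro p p' hp
    exact subC_mono (fun q hq => (hf hp).trans hq)
  · intro p
    exact subC_TF _ (good_of_le_const ⟨f p, le_rfl⟩ (fun q => q.2))
  · intro n σ
    exact mem_subC _ (fun i => hf (nv_mono σ (Fin.zero_le i)))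
  · intro n σ
    exact mem_subC _ (fun i => (hf (nv_mono σ (Fin.zero_le i))).trans (h _))

lemma nm_comp {R : Type} [Preorder R] (f : P → Q) (hf : Monotone f) (g : Q → R) (hg : Monotone g) : 
    nm f hf ≫ nm g hg = nm (g ∘ f) (hg.comp hf) := rfl

lemma nm_id : nm (id : P → P) monotone_id = 𝟙 _ := rfl

lemma good_retract (f : P → Q) (hf : Monotone f) (g : Q → P) (hg : Monotone g) 
    (h : (∀ p, p ≤ g (f p)) ∨ (∀ p, g (f p) ≤ p)) (hQ : Good Q) : Good P := by
  have : ContractibleSpace (SSet.toTop.obj (nerve Q)) := hQ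
  apply good_of_factor (SSet.toTop.map (nm f hf)) (SSet.toTop.map (nm g hg))
  rw [← Functor.map_comp, nm_comp, ← SSet.toTop.map_id, ← nm_id]
  rcases h with h | h
  · exact (homotopic_of_le id (g ∘ f) monotone_id _ h).symm
  · exact homotopic_of_le (g ∘ f) id _ monotone_id h

lemma good_zigzag (φ : P → P) (hφ : Monotone φ) (p0 : P) 
    (h : (∀ p, p ≤ φ p ∧ p0 ≤ φ p) ∨ (∀ p, φ p ≤ p ∧ φ p ≤ p0)) : Good P := by
  have : ContractibleSpace (SSet.toTop.obj (nerve PUnit.{1})) := 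
    good_of_le_const PUnit.unit (fun _ => le_rfl)
  apply good_of_factor (SSet.toTop.map (nm (fun _ : P => PUnit.unit) monotone_const)) 
    (SSet.toTop.map (nm (fun _ : PUnit => p0) monotone_const))
  rw [← Functor.map_comp, nm_comp, ← SSet.toTop.map_id, ← nm_id]
  rcases h with h | h
  · exact (homotopic_of_le _ φ _ hφ (fun p => (h p).2)).trans (homotopic_of_le id φ monotone_id hφ (fun p => (h p).1)).symm
  · exact (homotopic_of_le φ _ hφ _ (fun p => (h p).2)).symm.trans (homotopic_of_le φ id hφ monotone_id (fun p => (h p).1))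

theorem quillen (f : P → Q) (hf : Monotone f) (hQ : Good Q) (hfib : ∀ q, Good {p | q ≤ f p}) : Good P := by
  have hQ' : ContractibleSpace (SSet.toTop.obj (nerve Q)) := hQ
  have anti : ∀ q q' : Q, q ≤ q' → subC {p | q' ≤ f p} ≤ subC {p | q ≤ f p} := by
    intro q q' h
    exact subC_mono (fun p hp => h.trans hp)
  obtain ⟨g, -, hg⟩ := carrier (S := nerve Q) (X := TopCat.toSSet.obj (SSet.toTop.obj (nerve P))) 
    (fun n σ => subC {p | (σ.obj (0 : Fin (n.unop.len+1)) : Q) ≤ f p})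
    (by
      intro m n θ σ
      apply anti
      exact nv_mono σ (Fin.zero_le _))
    (fun n σ => subC_TF _ (hfib _)) ⊥ (SSet.Subcomplex.isInitialBot.to _) (by
      intro n a
      exact (show False from a.2).elim)
  have key : ContinuousMap.Homotopic (rl (nm f hf ≫ g)).hom (rl (un (nerve P))).hom := by
    apply cyl_homotopy (fun p => subC {p' | f p ≤ f p'})
    · intro p p' hp
      exact anti _ _ (hf hp)
    · intro p
      exact subC_TF _ (hfib _)
    · intro n σ
      exact hg n ((nm f hf).app n σ)
    · intro n σ
      exact mem_subC _ (fun i => hf (nv_mono σ (Fin.zero_le i)))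
  rw [rl_unit, ← comp_rl] at key
  exact good_of_factor _ _ key
end
end WFN
end partT5

section partA1

namespace WFN
open Polynomial.Chebyshev Module

section geom
variable {B : Type} (M : CoxeterMatrix B)

noncomputable def gk (i j : B) : ℝ := - (2 * Real.cos (Real.pi / M i j))

noncomputable def gf (i : B) : Dual ℝ (B →₀ ℝ) := Finsupp.linearCombination ℝ (fun j => gk M i j)

noncomputable def ge (i : B) : B →₀ ℝ := Finsupp.single i 1

lemma gf_ge (i j : B) : gf M i (ge j) = gk M i j := by simp [gf, ge]

lemma gf_self (i : B) : gf M i (ge i) = 2 := by simp [gf_ge, gk]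

noncomputable def gs (i : B) := reflection (gf_self M i)

lemma S_pi (θ : ℝ) (hs : Real.sin θ ≠ 0) (k : ℤ) : 
    (S ℝ k).eval (2 * Real.cos θ) = Real.sin ((k + 1) * θ) / Real.sin θ := by
  rw [eq_div_iff hs, S_two_mul_real_cos]

lemma gt_eq (i j : B) : gf M i (ge j) * gf M j (ge i) - 2 = 2 * Real.cos (2 * (Real.pi / M i j)) := by
  rw [gf_ge, gf_ge, gk, gk, M.symmetric j i, Real.cos_two_mul]
  ring

lemma sin_ne {m : ℕ} (hm : 3 ≤ m) : Real.sin (2 * (Real.pi / m)) ≠ 0 := by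
  have hm' : (3:ℝ) ≤ m := by exact_mod_cast hm
  apply ne_of_gt
  apply Real.sin_pos_of_pos_of_lt_pi
  · positivity
  · rw [← mul_div_assoc, div_lt_iff₀ (by linarith)]
    nlinarith [Real.pi_pos]

lemma M_ge_two {i j : B} (h : i ≠ j) (h0 : M i j ≠ 0) : 2 ≤ M i j := by
  have := M.off_diagonal i j h
  omega

lemma gs_rel (i j : B) : (gs M i * gs M j) ^ M i j = 1 := by
  by_cases hij : i = j
  · subst hij
    rw [M.diagonal, pow_one]
    ext1 x
    exact involutive_reflection (gf_self M i) x
  by_cases h0 : M i j = 0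
  · rw [h0, pow_zero]
  have h2 := M_ge_two M hij h0
  apply LinearEquiv.ext
  intro z
  refine (reflection_mul_reflection_pow_apply (gf_self M i) (gf_self M j) (M i j) z _ (gt_eq M i j).symm).trans ?_
  rcases h2.eq_or_lt with h2 | h3
  · have hk : gk M i j = 0 := by simp [gk, ← h2]
    have hk' : gk M j i = 0 := by simp [gk, M.symmetric j i, ← h2]
    rw [← h2]
    have : (2 * (Real.pi / (2:ℕ))) = Real.pi := by push_cast; ring
    rw [this]
    norm_num [gf_ge, hk, hk', S_one]
    module
  · have hs := sin_ne h3
    have hm0 : (M i j : ℝ) ≠ 0 := by exact_mod_cast h0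
    have hpi : (M i j : ℝ) * (Real.pi / M i j) = Real.pi := by field_simp
    set θ := Real.pi / M i j with hθ
    obtain ⟨n, hn | hn⟩ := Nat.even_or_odd' (M i j)
    · have e1 : ((M i j : ℤ) - 2) / 2 = n - 1 := by omega
      have e2 : ((M i j : ℤ) - 1) / 2 = n - 1 := by omega
      have hz : (S ℝ ((n:ℤ) - 1)).eval (2 * Real.cos (2 * θ)) = 0 := by
        rw [S_pi _ hs]
        have : (((n:ℤ) - 1 : ℤ) + 1 : ℝ) * (2 * θ) = Real.pi := by
          rw [← hpi, hn]; push_cast; ring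
        rw [this, Real.sin_pi, zero_div]
      rw [e1, e2, hz]
      simp
    · have e1 : ((M i j : ℤ) - 2) / 2 = n - 1 := by omega
      have e2 : ((M i j : ℤ) - 1) / 2 = n := by omega
      have e3 : ((M i j : ℤ) - 3) / 2 = n - 1 := by omega
      have e4 : (M i j : ℤ) / 2 = n := by omega
      have hz : (S ℝ (n:ℤ)).eval (2 * Real.cos (2 * θ)) + (S ℝ ((n:ℤ) - 1)).eval (2 * Real.cos (2 * θ)) = 0 := by
        rw [S_pi _ hs, S_pi _ hs, ← add_div]
        have e : (M i j : ℝ) = 2 * n + 1 := by rw [hn]; push_cast; ring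
        rw [e] at hpi
        have a1 : (((n:ℤ) : ℝ) + 1) * (2 * θ) = Real.pi + θ := by push_cast; linarith
        have a2 : ((((n:ℤ) - 1 : ℤ) : ℝ) + 1) * (2 * θ) = Real.pi - θ := by push_cast; linarith
        rw [a1, a2, Real.sin_pi_sub, add_comm Real.pi, Real.sin_add_pi]
        simp
      rw [e1, e2, e3, e4, hz]
      simp

lemma gs_order {i j : B} (hij : i ≠ j) {n : ℕ} (hn : 0 < n) (h : (gs M i * gs M j) ^ n = 1) : 
    M i j ≠ 0 ∧ M i j ≤ n := by
  have key := reflection_mul_reflection_pow_apply_self (gf_self M i) (gf_self M j) n _ (gt_eq M i j).symm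
  have h' : ((reflection (gf_self M i)) * reflection (gf_self M j)) ^ n = 1 := h
  rw [h'] at key
  have k1 := congrArg (fun v : B →₀ ℝ => v i) key
  have k2 := congrArg (fun v : B →₀ ℝ => v j) key
  simp only [ge, LinearEquiv.coe_one, id_eq, Finsupp.single_eq_same, Finsupp.coe_add, Finsupp.coe_smul, Pi.add_apply, Pi.smul_apply, smul_eq_mul, mul_one, Finsupp.single_eq_of_ne hij, Finsupp.single_eq_of_ne hij.symm, mul_zero, add_zero, zero_add] at k1 k2
  have hg : gf M j (Finsupp.single i 1) = gk M j i := gf_ge M j i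
  rw [hg] at k2
  by_cases h0 : M i j = 0
  · exfalso
    have hg0 : gk M j i = -2 := by simp [gk, M.symmetric j i, h0]
    rw [hg0, h0] at k2
    simp [S_eval_two] at k2
    omega
  refine ⟨h0, ?_⟩
  have h2 := M_ge_two M hij h0
  rcases h2.eq_or_lt with h2 | h3
  · by_contra hlt
    have : n = 1 := by omega
    subst this
    rw [← h2] at k1
    have e : (2 * (Real.pi / (2:ℕ))) = Real.pi := by push_cast; ring
    rw [e] at k1
    norm_num [S_one] at k1
  · have hs := sin_ne h3
    have hm3 : (3:ℝ) ≤ M i j := by exact_mod_cast h3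
    have hg0 : gk M j i ≠ 0 := by
      rw [gk, M.symmetric j i]
      have : 0 < Real.cos (Real.pi / M i j) := by
        apply Real.cos_pos_of_mem_Ioo
        constructor
        · have : 0 ≤ Real.pi / M i j := by positivity
          linarith [Real.pi_pos]
        · rw [div_lt_iff₀ (by linarith)]
          nlinarith [Real.pi_pos]
      linarith [this]
    have k3 : (S ℝ ((n:ℤ) - 1)).eval (2 * Real.cos (2 * (Real.pi / M i j))) = 0 := by
      rcases mul_eq_zero.1 k2.symm with h | h
      · exact h
      · exact absurd (neg_eq_zero.1 h) hg0
    rw [k3, add_zero, S_pi _ hs, eq_div_iff hs, one_mul] at k1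
    rw [S_pi _ hs, div_eq_zero_iff, or_iff_left hs] at k3
    push_cast at k1 k3
    rw [sub_add_cancel] at k3
    rw [add_mul, one_mul, Real.sin_add, k3, zero_mul, zero_add] at k1
    have k4 : Real.cos (n * (2 * (Real.pi / M i j))) = 1 := by
      have := mul_right_cancel₀ hs (k1.symm.trans (one_mul _).symm)
      exact this
    rw [Real.cos_eq_one_iff] at k4
    obtain ⟨k, hk⟩ := k4
    have hk2 : (k:ℝ) * M i j = n := by
      have hpi := Real.pi_pos.ne'
      have hm0 : (M i j : ℝ) ≠ 0 := by linarith
      field_simp at hk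
      linarith
    have hk3 : k * (M i j : ℤ) = n := by exact_mod_cast hk2
    have : 0 < k := by
      by_contra hk
      push Not at hk
      have : k * (M i j : ℤ) ≤ 0 := mul_nonpos_of_nonpos_of_nonneg hk (by positivity)
      omega
    have : (M i j : ℤ) ≤ n := by nlinarith
    exact_mod_cast this

variable {M} {W : Type} [Group W] (cs : CoxeterSystem M W)

lemma order_simple {i j : B} (hij : i ≠ j) {n : ℕ} (hn : 0 < n) (h : (cs.simple i * cs.simple j) ^ n = 1) : 
    M i j ≠ 0 ∧ M i j ≤ n := by
  apply gs_order M hij hn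
  have hl : M.IsLiftable (gs M) := gs_rel M
  have := congrArg (cs.lift ⟨gs M, hl⟩) h
  rwa [map_pow, map_mul, map_one, cs.lift_apply_simple, cs.lift_apply_simple] at this
end geom
end WFN
end partA1

section partA2

namespace WFN

section exch
variable {B : Type} {M : CoxeterMatrix B} {W : Type} [Group W] (cs : CoxeterSystem M W)
open Classical in
noncomputable def rr (i : B) : Function.End (W × ZMod 2) := 
  fun p => (cs.simple i * p.1 * cs.simple i, p.2 + if p.1 = cs.simple i then 1 else 0)

lemma sc_comm (i j : B) (n : ℕ) : (cs.simple i * cs.simple j) ^ n * cs.simple j * (cs.simple i * cs.simple j) ^ n = cs.simple j := by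
  induction n with
  | zero => simp
  | succ n ih =>
    rw [pow_succ (cs.simple i * cs.simple j)]
    nth_rw 2 [← pow_succ]
    rw [pow_succ' (cs.simple i * cs.simple j)]
    have : (cs.simple i * cs.simple j) ^ n * (cs.simple i * cs.simple j) * cs.simple j * 
      (cs.simple i * cs.simple j * (cs.simple i * cs.simple j) ^ n) = 
      (cs.simple i * cs.simple j) ^ n * (cs.simple i * (cs.simple j * cs.simple j) * (cs.simple i * cs.simple j)) * (cs.simple i * cs.simple j) ^ n := by simp only [mul_assoc]
    rw [this, cs.simple_mul_simple_self, mul_one, cs.simple_mul_simple_cancel_left, ih]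

open Classical in
lemma rr_pow (i j : B) (n : ℕ) (t : W) (e : ZMod 2) : ((rr cs i * rr cs j) ^ n : Function.End _) (t, e) = 
    ((cs.simple i * cs.simple j)^n * t * ((cs.simple i * cs.simple j)^n)⁻¹, 
      e + ∑ r ∈ Finset.range (2 * n), if t = cs.simple j * (cs.simple i * cs.simple j)^r then 1 else 0) := by
  induction n with
  | zero => simp; rfl
  | succ n ih =>
    rw [pow_succ']
    change (rr cs i) ((rr cs j) (((rr cs i * rr cs j) ^ n : Function.End _) (t, e))) = _
    rw [ih]
    have hc := sc_comm cs i j n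
    set c := cs.simple i * cs.simple j with hcdef
    have q1 : c ^ n * t * (c ^ n)⁻¹ = cs.simple j ↔ t = cs.simple j * c ^ (2 * n) := by
      rw [mul_inv_eq_iff_eq_mul, ← eq_inv_mul_iff_mul_eq]
      have : (c ^ n)⁻¹ * (cs.simple j * c ^ n) = cs.simple j * c ^ (2 * n) := by
        nth_rw 1 [← hc]
        rw [two_mul, pow_add]
        group
      rw [this]
    have q2 : cs.simple j * (c ^ n * t * (c ^ n)⁻¹) * cs.simple j = cs.simple i ↔ t = cs.simple j * c ^ (2 * n + 1) := by
      have : cs.simple j * (c ^ n * t * (c ^ n)⁻¹) * cs.simple j = cs.simple i ↔ 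
        c ^ n * t * (c ^ n)⁻¹ = cs.simple j * cs.simple i * cs.simple j := by
        constructor
        · intro h
          rw [← h]
          simp [mul_assoc]
        · intro h
          rw [h]
          simp [mul_assoc]
      rw [this, mul_inv_eq_iff_eq_mul, ← eq_inv_mul_iff_mul_eq]
      have : (c ^ n)⁻¹ * (cs.simple j * cs.simple i * cs.simple j * c ^ n) = cs.simple j * c ^ (2 * n + 1) := by
        rw [mul_assoc (cs.simple j), ← hcdef]
        nth_rw 1 [← hc]
        rw [two_mul, pow_add, pow_add, pow_one, mul_assoc (c^n) (c^n) c, ← pow_succ, pow_succ']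
        group
      rw [this]
    rw [show 2 * (n + 1) = 2 * n + 1 + 1 by ring, Finset.sum_range_succ, Finset.sum_range_succ]
    simp only [rr, q1, q2]
    ext
    · have hci : c⁻¹ = cs.simple j * cs.simple i := by rw [hcdef, mul_inv_rev, cs.inv_simple, cs.inv_simple]
      simp only [pow_succ' c, mul_inv_rev, hci]
      simp only [hcdef, mul_assoc]
    · simp only [add_assoc]

lemma rr_lift : M.IsLiftable (rr cs) := by
  classical
  intro i j
  funext p
  obtain ⟨t, e⟩ := p
  refine (rr_pow cs i j (M i j) t e).trans ?_
  have h1 : (cs.simple i * cs.simple j) ^ M i j = 1 := cs.simple_mul_simple_pow i j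
  rw [two_mul, Finset.sum_range_add]
  simp only [pow_add, h1, one_mul, inv_one, mul_one]
  rw [CharTwo.add_self_eq_zero, add_zero]
  rfl

noncomputable def rrh : W →* Function.End (W × ZMod 2) := cs.lift ⟨rr cs, rr_lift cs⟩

open Classical in
lemma rrh_word (l : List B) (t : W) (e : ZMod 2) : 
    rrh cs (cs.wordProd l) (t, e) = (cs.wordProd l * t * (cs.wordProd l)⁻¹, e + (cs.rightInvSeq l).count t) := by
  induction l with
  | nil => simp; rfl
  | cons i l ih =>
    rw [cs.wordProd_cons, map_mul]
    change rrh cs (cs.simple i) (rrh cs (cs.wordProd l) (t, e)) = _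
    rw [ih, rrh, cs.lift_apply_simple]
    simp only [rr, CoxeterSystem.rightInvSeq, List.count_cons]
    have : cs.wordProd l * t * (cs.wordProd l)⁻¹ = cs.simple i ↔ (cs.wordProd l)⁻¹ * cs.simple i * cs.wordProd l = t := by
      constructor
      · intro h; rw [← h]; group
      · intro h; rw [← h]; group
    simp only [this, beq_iff_eq]
    ext
    · simp [mul_assoc]
    · push_cast
      rw [add_assoc]

lemma exch_right (l : List B) (i : B) (h : cs.IsRightDescent (cs.wordProd l) i) : cs.simple i ∈ cs.rightInvSeq l := by
  classical
  by_contra hn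
  obtain ⟨l', hl', he⟩ := cs.exists_isReduced (cs.wordProd l * cs.simple i)
  have h1 := rrh_word cs l' (cs.simple i) 0
  rw [← he, map_mul] at h1
  have h2 : rrh cs (cs.simple i) (cs.simple i, 0) = (cs.simple i, 1) := by
    rw [rrh, cs.lift_apply_simple]
    simp [rr]
  have h3 : rrh cs (cs.wordProd l) (rrh cs (cs.simple i) (cs.simple i, 0)) = _ := h1
  rw [h2, rrh_word, List.count_eq_zero_of_not_mem hn] at h3
  have h4 := congrArg Prod.snd h3
  have h5 : cs.simple i ∈ cs.rightInvSeq l' := by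
    by_contra h5
    rw [List.count_eq_zero_of_not_mem h5] at h4
    simp at h4
  have h6 := (cs.isRightInversion_of_mem_rightInvSeq hl' h5).2
  rw [← he, cs.simple_mul_simple_cancel_right] at h6
  exact absurd h (by unfold CoxeterSystem.IsRightDescent; omega)

lemma exch_left_mem (l : List B) (i : B) (h : cs.IsLeftDescent (cs.wordProd l) i) : cs.simple i ∈ cs.leftInvSeq l := by
  have := exch_right cs l.reverse i (by rwa [cs.wordProd_reverse, cs.isRightDescent_inv_iff])
  rwa [cs.rightInvSeq_reverse, List.mem_reverse] at this

lemma exch_left (l : List B) (i : B) (h : cs.IsLeftDescent (cs.wordProd l) i) : 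
    ∃ j, j < l.length ∧ cs.simple i * cs.wordProd l = cs.wordProd (l.eraseIdx j) ∧ 
      cs.simple i = cs.wordProd (l.take j) * cs.wordProd [l.getD j i] * (cs.wordProd (l.take j))⁻¹ := by
  have := exch_left_mem cs l i h
  obtain ⟨j, hj, he⟩ := List.getElem_of_mem this
  have hj' : j < l.length := by simpa using hj
  refine ⟨j, hj', ?_, ?_⟩
  · rw [← cs.getD_leftInvSeq_mul_wordProd, List.getD_eq_getElem _ _ hj, he]
  · rw [← he, cs.getElem_leftInvSeq l j hj', List.getD_eq_getElem _ _ hj', cs.wordProd_singleton]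
end exch
end WFN
end partA2

section partA3

namespace WFN
open CoxeterSystem

section dihedral
variable {B : Type}

/-- alternating word of length k starting with i -/
def aw (i j : B) : ℕ → List B
  | 0 => []
  | k+1 => i :: aw j i k

@[simp] lemma aw_zero (i j : B) : aw i j 0 = [] := rfl
lemma aw_succ (i j : B) (k : ℕ) : aw i j (k+1) = i :: aw j i k := rfl
@[simp] lemma length_aw (i j : B) (k : ℕ) : (aw i j k).length = k := by
  induction k generalizing i j with
  | zero => rfl
  | succ k ih => simp [aw_succ, ih]

lemma mem_aw {i j x : B} {k : ℕ} (h : x ∈ aw i j k) : x = i ∨ x = j := by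
  induction k generalizing i j with
  | zero => simp at h
  | succ k ih => 
    rw [aw_succ, List.mem_cons] at h
    rcases h with h | h
    · exact Or.inl h
    · exact (ih h).symm

lemma alt_rev (i j : B) (k : ℕ) : (alternatingWord i j k).reverse = aw j i k := by
  induction k generalizing i j with
  | zero => rfl
  | succ k ih => simp [alternatingWord_succ, aw_succ, ih]

lemma alt_eq (i j : B) (k : ℕ) : alternatingWord i j k = if Even k then aw i j k else aw j i k := by
  induction k generalizing i j with
  | zero => rfl
  | succ k ih => 
    rw [alternatingWord_succ', ih]
    by_cases h : Even k
    · have h' : ¬ Even (k+1) := by rw [Nat.even_add_one]; exact fun h2 => h2 h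
      simp [h, h', aw_succ]
    · have h' : Even (k+1) := Nat.even_add_one.2 h
      simp [h, h', aw_succ]

lemma aw_rev (i j : B) (k : ℕ) : (aw i j k).reverse = aw i j k ∨ (aw i j k).reverse = aw j i k := by
  have h := alt_rev j i k
  have h2 : (aw i j k).reverse = alternatingWord j i k := by rw [← h, List.reverse_reverse]
  rw [h2, alt_eq j i k]
  split_ifs
  · exact Or.inr rfl
  · exact Or.inl rfl

lemma aw_take (i j : B) (p k : ℕ) (h : p ≤ k) : (aw i j k).take p = aw i j p := by
  induction p generalizing i j k with
  | zero => simp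
  | succ p ih =>
    obtain ⟨k, rfl⟩ : ∃ k', k = k' + 1 := ⟨k - 1, by omega⟩
    simp [aw_succ, ih j i k (by omega)]

variable {M : CoxeterMatrix B} {W : Type} [Group W] (cs : CoxeterSystem M W)

lemma conj_pow' (a b : W) (n : ℕ) : a * (b * a) ^ n * b = (a * b) ^ (n+1) := by
  induction n with
  | zero => simp
  | succ n ih => rw [pow_succ (b*a), pow_succ (a*b), ← ih]; simp only [mul_assoc]

lemma aw_quot (i j : B) (n : ℕ) : cs.wordProd (aw i j n) * (cs.wordProd (aw j i n))⁻¹ = (cs.simple i * cs.simple j) ^ n := by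
  induction n generalizing i j with
  | zero => simp
  | succ n ih =>
    rw [aw_succ, aw_succ, cs.wordProd_cons, cs.wordProd_cons, ← conj_pow', ← ih j i]
    simp [mul_assoc]

lemma aw_braid (i j : B) : cs.wordProd (aw i j (M i j)) = cs.wordProd (aw j i (M i j)) := by
  rw [← mul_inv_eq_one, aw_quot, cs.simple_mul_simple_pow]

lemma red_cons {l : List B} (h : cs.IsReduced l) {i : B} (hi : ¬ cs.IsLeftDescent (cs.wordProd l) i) : cs.IsReduced (i :: l) := by
  rw [cs.not_isLeftDescent_iff, ← cs.wordProd_cons, h.eq] at hi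
  unfold CoxeterSystem.IsReduced
  simpa using hi

lemma aw_reduced {i j : B} (hij : i ≠ j) (k : ℕ) (hk : M i j = 0 ∨ k ≤ M i j) : cs.IsReduced (aw i j k) := by
  induction k generalizing i j with
  | zero => simp [CoxeterSystem.IsReduced]
  | succ k ih =>
    rw [aw_succ]
    have hr := ih (i := j) (j := i) hij.symm (by rw [M.symmetric]; omega)
    apply red_cons cs hr
    intro hd
    obtain ⟨p, hp, -, he⟩ := exch_left cs _ _ hd
    rw [length_aw] at hp
    have h1 : (aw j i k).take p ++ [(aw j i k).getD p i] = aw j i (p+1) := by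
      rw [List.getD_eq_getElem _ _ (by simpa using hp), ← aw_take j i (p+1) k (by omega), List.take_succ_eq_append_getElem]
    have h2 : cs.wordProd (aw i j (p+1)) = cs.wordProd (aw j i (p+1)) := by
      rw [← h1, cs.wordProd_append, aw_succ, cs.wordProd_cons, ← aw_take j i p k (by omega)]
      nth_rw 1 [he]
      simp
    rw [← mul_inv_eq_one, aw_quot] at h2
    have := order_simple cs hij (Nat.succ_pos p) h2
    omega

/-- minimal in its left coset under the dihedral subgroup -/
def CMin (i j : B) (x : W) : Prop := ∀ l : List B, (∀ a ∈ l, a = i ∨ a = j) → cs.length x ≤ cs.length (cs.wordProd l * x)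

lemma CMin.symm {i j : B} {x : W} (h : CMin cs i j x) : CMin cs j i x := fun l hl => h l (fun a ha => (hl a ha).symm)

lemma coset_len {i j : B} (hij : i ≠ j) {x : W} (hx : CMin cs i j x) (k : ℕ) (hk : M i j = 0 ∨ k ≤ M i j) : 
    cs.length (cs.wordProd (aw i j k) * x) = k + cs.length x := by
  induction k generalizing i j with
  | zero => simp
  | succ k ih =>
    have hr := ih (i := j) (j := i) hij.symm (CMin.symm cs hx) (by rw [M.symmetric]; omega)
    rw [aw_succ, cs.wordProd_cons, mul_assoc]
    by_cases hd : cs.IsLeftDescent (cs.wordProd (aw j i k) * x) i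
    · exfalso
      obtain ⟨lx, hlx, rfl⟩ := cs.exists_isReduced x
      rw [← cs.wordProd_append] at hd
      obtain ⟨p, hp, he, -⟩ := exch_left cs _ _ hd
      by_cases hpk : p < k
      · rw [List.eraseIdx_append_of_lt_length (by simpa using hpk), cs.wordProd_append, cs.wordProd_append, ← mul_assoc, mul_left_inj, ← cs.wordProd_cons, ← aw_succ] at he
        have h1 := (aw_reduced cs hij (k+1) hk).eq
        rw [he, length_aw] at h1
        have h2 := cs.length_wordProd_le ((aw j i k).eraseIdx p)
        rw [List.length_eraseIdx] at h2
        split_ifs at h2 <;> simp at h2 <;> omega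
      · push Not at hpk
        rw [List.eraseIdx_append_of_length_le (by simpa using hpk), cs.wordProd_append, cs.wordProd_append] at he
        have h1 := hx ((aw j i k).reverse ++ (i :: aw j i k)) (by
          intro a ha
          simp only [List.mem_append, List.mem_reverse, List.mem_cons] at ha
          rcases ha with h | h | h
          · exact (mem_aw h).symm
          · exact Or.inl h
          · exact (mem_aw h).symm)
        rw [cs.wordProd_append, cs.wordProd_cons, cs.wordProd_reverse, mul_assoc, mul_assoc, he, inv_mul_cancel_left, hlx.eq] at h1
        have h2 := cs.length_wordProd_le (lx.eraseIdx (p - (aw j i k).length))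
        rw [List.length_append, length_aw] at hp
        rw [List.length_eraseIdx, length_aw] at h2
        rw [length_aw] at h1
        rw [if_pos (by omega)] at h2
        omega
    · rw [cs.not_isLeftDescent_iff] at hd
      rw [hd, hr]
      omega

lemma dih_closed {i j : B} (hij : i ≠ j) (l : List B) (hl : ∀ a ∈ l, a = i ∨ a = j) : 
    ∃ a b k, ((a = i ∧ b = j) ∨ (a = j ∧ b = i)) ∧ (M i j = 0 ∨ k ≤ M i j) ∧ cs.wordProd l = cs.wordProd (aw a b k) := by
  induction l with
  | nil => exact ⟨i, j, 0, Or.inl ⟨rfl, rfl⟩, by omega, rfl⟩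
  | cons c l ih =>
    obtain ⟨a, b, k, hab, hk, he⟩ := ih (fun a ha => hl a (List.mem_cons_of_mem _ ha))
    rw [cs.wordProd_cons, he]
    have hM : M a b = M i j := by
      rcases hab with ⟨rfl, rfl⟩ | ⟨rfl, rfl⟩
      · rfl
      · rw [M.symmetric]
    have hc : c = a ∨ c = b := by
      have := hl c (by simp)
      rcases hab with ⟨rfl, rfl⟩ | ⟨rfl, rfl⟩
      · exact this
      · exact this.symm
    have hab' : (b = i ∧ a = j) ∨ (b = j ∧ a = i) := by tauto
    rcases hc with rfl | rfl
    · cases k with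
      | zero =>
        refine ⟨c, b, 1, hab, ?_, ?_⟩
        · by_cases h0 : M i j = 0
          · exact Or.inl h0
          · right; omega
        · simp [aw_succ]
      | succ k =>
        refine ⟨b, c, k, hab', by omega, ?_⟩
        rw [aw_succ, cs.wordProd_cons, cs.simple_mul_simple_cancel_left]
    · by_cases hk' : k = M i j ∧ M i j ≠ 0
      · rw [← hM] at hk'
        obtain ⟨rfl, h0⟩ := hk'
        refine ⟨a, c, M a c - 1, hab, by omega, ?_⟩
        rw [aw_braid]
        obtain ⟨k, hk2⟩ : ∃ k, M a c = k + 1 := ⟨M a c - 1, by omega⟩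
        rw [hk2, aw_succ, cs.wordProd_cons, cs.simple_mul_simple_cancel_left]
        simp
      · refine ⟨c, a, k+1, hab', by omega, ?_⟩
        rw [aw_succ, cs.wordProd_cons]

lemma exists_cmin (i j : B) (w : W) : ∃ l x, (∀ a ∈ l, a = i ∨ a = j) ∧ w = cs.wordProd l * x ∧ CMin cs i j x := by
  classical
  have hne : ∃ n, ∃ l : List B, (∀ a ∈ l, a = i ∨ a = j) ∧ cs.length (cs.wordProd l * w) = n := 
    ⟨_, [], by simp, rfl⟩
  obtain ⟨l, hl, hn⟩ := Nat.find_spec hne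
  refine ⟨l.reverse, cs.wordProd l * w, by simpa using hl, by simp, ?_⟩
  intro l' hl'
  rw [hn, ← mul_assoc, ← cs.wordProd_append]
  apply Nat.find_min'
  refine ⟨l' ++ l, ?_, rfl⟩
  intro a ha
  rcases List.mem_append.1 ha with h | h
  · exact hl' a h
  · exact hl a h

lemma coset_decomp {i j : B} (hij : i ≠ j) (w : W) : ∃ a b k x, ((a = i ∧ b = j) ∨ (a = j ∧ b = i)) ∧ (M i j = 0 ∨ k ≤ M i j) ∧ 
    w = cs.wordProd (aw a b k) * x ∧ CMin cs i j x ∧ cs.length w = k + cs.length x := by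
  obtain ⟨l, x, hl, rfl, hx⟩ := exists_cmin cs i j w
  obtain ⟨a, b, k, hab, hk, he⟩ := dih_closed cs hij l hl
  refine ⟨a, b, k, x, hab, hk, by rw [he], hx, ?_⟩
  rw [he]
  rcases hab with ⟨rfl, rfl⟩ | ⟨rfl, rfl⟩
  · exact coset_len cs hij hx k hk
  · exact coset_len cs hij.symm (CMin.symm cs hx) k (by rwa [M.symmetric])

theorem dih_left {i j : B} (hij : i ≠ j) (w : W) (hi : cs.IsLeftDescent w i) (hj : cs.IsLeftDescent w j) : 
    M i j ≠ 0 ∧ ∃ x, w = cs.wordProd (aw i j (M i j)) * x ∧ cs.length w = M i j + cs.length x := by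
  obtain ⟨a, b, k, x, hab, hk, hw, hx, hl⟩ := coset_decomp cs hij w
  have hM : M a b = M i j := by
    rcases hab with ⟨rfl, rfl⟩ | ⟨rfl, rfl⟩
    · rfl
    · rw [M.symmetric]
  have hb : cs.IsLeftDescent w b := by
    rcases hab with ⟨rfl, rfl⟩ | ⟨rfl, rfl⟩
    · exact hj
    · exact hi
  have key : ¬ (M i j = 0 ∨ k + 1 ≤ M i j) := by
    intro hk1
    have : cs.length (cs.wordProd (aw b a (k+1)) * x) = (k+1) + cs.length x := by
      rcases hab with ⟨rfl, rfl⟩ | ⟨rfl, rfl⟩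
      · exact coset_len cs hij.symm (CMin.symm cs hx) (k+1) (by rwa [M.symmetric])
      · exact coset_len cs hij hx (k+1) hk1
    rw [aw_succ, cs.wordProd_cons, mul_assoc, ← hw] at this
    unfold IsLeftDescent at hb
    omega
  have hkM : k = M i j := by omega
  refine ⟨by omega, x, ?_, by omega⟩
  rw [hw, hkM]
  rcases hab with ⟨rfl, rfl⟩ | ⟨rfl, rfl⟩
  · rfl
  · rw [aw_braid cs b a, M.symmetric]

theorem dih_right {i j : B} (hij : i ≠ j) (h0 : M i j ≠ 0) (v : W) (hi : ¬ cs.IsRightDescent v i) (hj : ¬ cs.IsRightDescent v j) : 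
    cs.length (v * cs.wordProd (aw i j (M i j))) = cs.length v + M i j := by
  obtain ⟨a, b, k, x, hab, hk, hw, hx, hl⟩ := coset_decomp cs hij v⁻¹
  have hk0 : k = 0 := by
    by_contra hk0
    obtain ⟨k, rfl⟩ : ∃ k', k = k' + 1 := ⟨k - 1, by omega⟩
    have ha : ¬ cs.IsLeftDescent v⁻¹ a := by
      rw [cs.isLeftDescent_inv_iff]
      rcases hab with ⟨rfl, rfl⟩ | ⟨rfl, rfl⟩
      · exact hi
      · exact hj
    have : cs.simple a * v⁻¹ = cs.wordProd (aw b a k) * x := by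
      rw [hw, aw_succ, cs.wordProd_cons, mul_assoc, cs.simple_mul_simple_cancel_left]
    have h2 : cs.length (cs.wordProd (aw b a k) * x) = k + cs.length x := by
      rcases hab with ⟨rfl, rfl⟩ | ⟨rfl, rfl⟩
      · exact coset_len cs hij.symm (CMin.symm cs hx) k (by rw [M.symmetric]; omega)
      · exact coset_len cs hij hx k (by omega)
    rw [cs.not_isLeftDescent_iff, this] at ha
    omega
  subst hk0
  simp at hw
  subst hw
  rw [← cs.length_inv, mul_inv_rev, ← cs.wordProd_reverse]
  have h1 := coset_len cs hij hx (M i j) (by omega)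
  rw [cs.length_inv] at h1
  rcases aw_rev i j (M i j) with h | h
  · rw [h, h1]; omega
  · rw [h, ← aw_braid, h1]; omega
end dihedral
end WFN
end partA3

section partA4

namespace WFN
open CoxeterSystem

section basics
variable {B : Type} {M : CoxeterMatrix B}

lemma bmk_nil : M.braidMk [] = 1 := rfl
lemma bmk_append (l l' : List B) : M.braidMk (l ++ l') = M.braidMk l * M.braidMk l' := rfl
lemma bmk_cons (i : B) (l : List B) : M.braidMk (i :: l) = M.braidMk [i] * M.braidMk l := rfl

lemma bmk_surj (b : M.BraidMonoid) : ∃ l, M.braidMk l = b := by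
  obtain ⟨l, hl⟩ := Con.mk'_surjective (c := conGen M.braidRels) b
  exact ⟨FreeMonoid.toList l, hl⟩

lemma bmk_alt (i j : B) : M.braidMk (alternatingWord i j (M i j)) = M.braidMk (alternatingWord j i (M i j)) :=
  (Con.eq _).2 (ConGen.Rel.of _ _ ⟨i, j, rfl, rfl⟩)

lemma bmk_aw (i j : B) : M.braidMk (aw i j (M i j)) = M.braidMk (aw j i (M i j)) := by
  have h := bmk_alt (M := M) i j
  rw [alt_eq, alt_eq] at h
  split_ifs at h
  · exact h
  · exact h.symm

/-- universal property -/
noncomputable def bl {Q : Type} [Monoid Q] (f : B → Q) (hf : ∀ i j, ((aw i j (M i j)).map f).prod = ((aw j i (M i j)).map f).prod) :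
    M.BraidMonoid →* Q :=
  PresentedMonoid.lift f (by
    rintro a b ⟨i, j, rfl, rfl⟩
    rw [FreeMonoid.lift_apply, FreeMonoid.lift_apply, FreeMonoid.toList_ofList, FreeMonoid.toList_ofList,
      alt_eq, alt_eq]
    split_ifs
    · exact hf i j
    · exact (hf i j).symm)

lemma bl_mk {Q : Type} [Monoid Q] (f : B → Q) (hf : ∀ i j, ((aw i j (M i j)).map f).prod = ((aw j i (M i j)).map f).prod)
    (l : List B) : bl (M := M) f hf (M.braidMk l) = (l.map f).prod := by
  induction l with
  | nil => simp [bmk_nil]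
  | cons a l ih =>
    rw [bmk_cons, map_mul, ih, List.map_cons, List.prod_cons]
    rfl

/-- length hom -/
noncomputable def blenH (M : CoxeterMatrix B) : M.BraidMonoid →* Multiplicative ℕ := bl (fun _ => Multiplicative.ofAdd 1) (by intro i j; simp)

noncomputable def blen (b : M.BraidMonoid) : ℕ := Multiplicative.toAdd (blenH M b)

@[simp] lemma blen_mk (l : List B) : blen (M.braidMk l) = l.length := by
  simp [blen, blenH, bl_mk]
@[simp] lemma blen_mul (a b : M.BraidMonoid) : blen (a * b) = blen a + blen b := by simp [blen]
@[simp] lemma blen_one : blen (1 : M.BraidMonoid) = 0 := by simp [blen]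

lemma blen_eq_zero {b : M.BraidMonoid} (h : blen b = 0) : b = 1 := by
  obtain ⟨l, rfl⟩ := bmk_surj b
  rw [blen_mk, List.length_eq_zero_iff] at h
  subst h; rfl

lemma ne_one_iff {b : M.BraidMonoid} : b ≠ 1 ↔ 0 < blen b := by
  constructor
  · intro h; by_contra h2; exact h (blen_eq_zero (by omega))
  · rintro h rfl; simp at h

/-- generator -/
noncomputable def sg (M : CoxeterMatrix B) (i : B) : M.BraidMonoid := M.braidMk [i]

lemma bmk_cons' (i : B) (l : List B) : M.braidMk (i :: l) = sg M i * M.braidMk l := rfl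
@[simp] lemma blen_sg (i : B) : blen (sg M i) = 1 := by simp [sg]

lemma exists_sg {b : M.BraidMonoid} (h : b ≠ 1) : ∃ i c, b = sg M i * c := by
  obtain ⟨l, rfl⟩ := bmk_surj b
  cases l with
  | nil => exact absurd rfl h
  | cons a l => exact ⟨a, _, bmk_cons' a l⟩

noncomputable def bpi (M : CoxeterMatrix B) : M.BraidMonoid →* M.Group := bl M.simple (by
  intro i j
  exact aw_braid M.toCoxeterSystem i j)

lemma bpi_mk (l : List B) : bpi M (M.braidMk l) = M.toCoxeterSystem.wordProd l := bl_mk _ _ l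
lemma bpi_sg (i : B) : bpi M (sg M i) = M.toCoxeterSystem.simple i := by simp [sg, bpi_mk]

open Classical in
noncomputable def bsuppH (M : CoxeterMatrix B) : M.BraidMonoid →* (B → ℕ) := bl (fun s i => if i = s then 0 else 1) (by
  intro i j
  by_cases hij : i = j
  · subst hij; rfl
  by_cases h0 : M i j = 0
  · simp [h0]
  have h2 := M_ge_two M hij h0
  obtain ⟨k, hk⟩ : ∃ k, M i j = k + 2 := ⟨M i j - 2, by omega⟩
  have key : ∀ (i j : B) k, i ≠ j → ((aw i j (k+2)).map (fun (s i : B) => if i = s then 0 else 1)).prod = (fun x => if x = i ∨ x = j then 0 else 1) := by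
    intro i j k hij
    funext x
    have e : ∀ L : List (B → ℕ), L.prod x = (L.map (fun f => f x)).prod := by
      intro L; induction L <;> simp [*]
    refine (e _).trans ?_
    by_cases hx : x = i ∨ x = j
    · rw [if_pos hx, aw_succ, aw_succ]
      simp; tauto
    · rw [if_neg hx]
      apply List.prod_eq_one
      intro y hy
      simp only [List.map_map, List.mem_map] at hy
      obtain ⟨z, hz, rfl⟩ := hy
      have := mem_aw hz
      simp
      rintro rfl; tauto
  rw [hk, key i j k hij, key j i k (Ne.symm hij)]
  funext x; simp [or_comm])

noncomputable def bsupp (b : M.BraidMonoid) : Set B := {i | bsuppH M b i = 0}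

lemma bsupp_mul (a b : M.BraidMonoid) : bsupp (a * b) = bsupp a ∪ bsupp b := by
  ext i; simp [bsupp]
@[simp] lemma bsupp_one : bsupp (1 : M.BraidMonoid) = ∅ := by ext i; simp [bsupp]
@[simp] lemma bsupp_sg (i : B) : bsupp (sg M i) = {i} := by
  ext x; simp [bsupp, sg, bsuppH, bl_mk]
lemma bsupp_mk (l : List B) : bsupp (M.braidMk l) = {i | i ∈ l} := by
  induction l with
  | nil => rw [bmk_nil]; simp
  | cons a l ih => rw [bmk_cons', bsupp_mul, ih, bsupp_sg]; ext x; simp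

/-- finite type sets of letters -/
def FT (M : CoxeterMatrix B) (S : Set B) : Prop := (Subgroup.closure (M.simple '' S) : Set M.Group).Finite

lemma FT.mono {S T : Set B} (h : FT M T) (hs : S ⊆ T) : FT M S :=
  Set.Finite.subset h (Subgroup.closure_mono (Set.image_mono hs))

lemma ft_iff (b : M.BraidMonoid) : M.FiniteTypeBraid b ↔ FT M (bsupp b) := by
  constructor
  · rintro ⟨l, rfl, h⟩; rw [bsupp_mk]; exact h
  · intro h; obtain ⟨l, rfl⟩ := bmk_surj b; rw [bsupp_mk] at h; exact ⟨l, rfl, h⟩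

local notation "cs" => M.toCoxeterSystem

/-- reduced -/
abbrev Rd (b : M.BraidMonoid) : Prop := M.ReducedBraid b

lemma rd_iff (b : M.BraidMonoid) : Rd b ↔ (cs).length (bpi M b) = blen b := by
  constructor
  · rintro ⟨l, rfl, h⟩; rw [bpi_mk, blen_mk]; exact h
  · intro h; obtain ⟨l, rfl⟩ := bmk_surj b; rw [bpi_mk, blen_mk] at h; exact ⟨l, rfl, h⟩

lemma len_le (b : M.BraidMonoid) : (cs).length (bpi M b) ≤ blen b := by
  obtain ⟨l, rfl⟩ := bmk_surj b
  rw [bpi_mk, blen_mk]; exact (cs).length_wordProd_le l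

lemma rd_mul {x y : M.BraidMonoid} (h : Rd (x * y)) : Rd x ∧ Rd y := by
  rw [rd_iff] at *
  rw [rd_iff, map_mul, blen_mul] at *
  have h1 := len_le x
  have h2 := len_le y
  have h3 := (cs).length_mul_le (bpi M x) (bpi M y)
  omega

lemma rd_one : Rd (1 : M.BraidMonoid) := by rw [rd_iff]; simp
lemma rd_sg (i : B) : Rd (sg M i) := by rw [rd_iff, bpi_sg, (cs).length_simple, blen_sg]

/-- a reduced lift -/
lemma exists_lift (w : M.Group) : ∃ b : M.BraidMonoid, bpi M b = w ∧ Rd b := by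
  obtain ⟨l, hl, rfl⟩ := (cs).exists_isReduced w
  exact ⟨M.braidMk l, bpi_mk l, l, rfl, hl⟩

lemma rd_sg_mul_iff {i : B} {b : M.BraidMonoid} (h : Rd b) : Rd (sg M i * b) ↔ ¬ (cs).IsLeftDescent (bpi M b) i := by
  rw [rd_iff] at *
  rw [(cs).not_isLeftDescent_iff, map_mul, blen_mul, bpi_sg, blen_sg, h, add_comm]

lemma rd_mul_sg_iff {i : B} {b : M.BraidMonoid} (h : Rd b) : Rd (b * sg M i) ↔ ¬ (cs).IsRightDescent (bpi M b) i := by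
  rw [rd_iff] at *
  rw [(cs).not_isRightDescent_iff, map_mul, blen_mul, bpi_sg, blen_sg, h]

/-- Matsumoto -/
theorem matsumoto (n : ℕ) : ∀ (a b : M.BraidMonoid), blen a = n → Rd a → Rd b → bpi M a = bpi M b → a = b := by
  induction n with
  | zero =>
    intro a b hn ha hb h
    rw [rd_iff] at ha hb
    rw [blen_eq_zero hn, blen_eq_zero (b := b) (by rw [← hb, ← h, ha, hn])]
  | succ n ih =>
    intro a b hn ha hb h
    have hl : blen b = n + 1 := by rw [rd_iff] at ha hb; rw [← hb, ← h, ha, hn]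
    obtain ⟨i, a', rfl⟩ := exists_sg (b := a) (by rw [ne_one_iff]; omega)
    obtain ⟨j, b', rfl⟩ := exists_sg (b := b) (by rw [ne_one_iff]; omega)
    have ha' := (rd_mul ha).2
    have hb' := (rd_mul hb).2
    simp only [blen_mul, blen_sg] at hn hl
    by_cases hij : i = j
    · subst hij
      rw [map_mul, map_mul] at h
      rw [ih a' b' (by omega) ha' hb' (mul_left_cancel h)]
    have di : ∀ (k : B) (c : M.BraidMonoid), Rd (sg M k * c) → (cs).IsLeftDescent (bpi M (sg M k * c)) k := by
      intro k c hc
      have h1 := hc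
      rw [rd_iff] at h1
      have h2 := (rd_mul hc).2
      rw [rd_iff] at h2
      unfold CoxeterSystem.IsLeftDescent
      rw [h1, map_mul, bpi_sg, (cs).simple_mul_simple_cancel_left, h2]
      simp
    obtain ⟨h0, x, hx, hlx⟩ := dih_left cs hij _ (di i a' ha) (h ▸ di j b' hb)
    obtain ⟨m, hm⟩ : ∃ m, M i j = m + 1 := ⟨M i j - 1, by omega⟩
    obtain ⟨y, rfl, hy⟩ := exists_lift x
    have e1 : sg M i * (M.braidMk (aw j i m) * y) = sg M j * (M.braidMk (aw i j m) * y) := by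
      rw [← mul_assoc, ← mul_assoc, ← bmk_cons', ← bmk_cons', ← aw_succ, ← aw_succ, ← hm, bmk_aw]
    have hbp : bpi M (sg M i * (M.braidMk (aw j i m) * y)) = bpi M (sg M i * a') := by
      rw [hx, ← mul_assoc, ← bmk_cons', ← aw_succ, ← hm, map_mul, bpi_mk]
    have hlen : blen (sg M i * (M.braidMk (aw j i m) * y)) = blen (sg M i * a') := by
      rw [← (rd_iff _).1 ha, hlx, (rd_iff _).1 hy]
      simp; omega
    have hR : Rd (sg M i * (M.braidMk (aw j i m) * y)) := by
      rw [rd_iff, hbp, hlen]; exact (rd_iff _).1 ha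
    have r1 : a' = M.braidMk (aw j i m) * y := by
      apply ih a' _ (by omega) ha' (rd_mul hR).2
      rw [map_mul, map_mul (bpi M) (sg M i) a'] at hbp
      exact (mul_left_cancel hbp).symm
    have r2 : b' = M.braidMk (aw i j m) * y := by
      rw [e1, h] at hbp
      apply ih b' _ (by omega) hb' (rd_mul (e1 ▸ hR)).2
      rw [map_mul, map_mul (bpi M) (sg M j) b'] at hbp
      exact (mul_left_cancel hbp).symm
    rw [r1, r2, e1]

lemma rd_ext {a b : M.BraidMonoid} (ha : Rd a) (hb : Rd b) (h : bpi M a = bpi M b) : a = b := matsumoto _ a b rfl ha hb h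

/-- Delta of two letters -/
noncomputable def dl (M : CoxeterMatrix B) (i j : B) : M.BraidMonoid := M.braidMk (aw i j (M i j))
lemma dl_symm (i j : B) : dl M i j = dl M j i := by
  rw [dl, bmk_aw, dl, M.symmetric j i]

lemma sg_dvd_dl {i j : B} (h0 : M i j ≠ 0) : sg M i ∣ dl M i j := by
  obtain ⟨m, hm⟩ : ∃ m, M i j = m + 1 := ⟨M i j - 1, by omega⟩
  rw [dl, hm, aw_succ, bmk_cons']; exact dvd_mul_right _ _

lemma bsupp_dl (i j : B) : bsupp (dl M i j) ⊆ {i, j} := by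
  rw [dl, bsupp_mk]; intro x hx; exact mem_aw hx

lemma sg_dvd_iff {i : B} {b : M.BraidMonoid} (hb : Rd b) : sg M i ∣ b ↔ (cs).IsLeftDescent (bpi M b) i := by
  constructor
  · rintro ⟨c, rfl⟩
    by_contra h
    rw [(cs).not_isLeftDescent_iff] at h
    rw [map_mul, bpi_sg, (cs).simple_mul_simple_cancel_left] at h
    have := (rd_iff _).1 hb
    rw [map_mul, bpi_sg] at this
    have h2 := len_le c
    rw [blen_mul, blen_sg] at this
    omega
  · intro h
    obtain ⟨c, hc, hcr⟩ := exists_lift ((cs).simple i * bpi M b)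
    refine ⟨c, rd_ext hb ?_ ?_⟩
    · rw [rd_sg_mul_iff hcr, hc, (cs).isLeftDescent_iff_not_isLeftDescent_mul, not_not, (cs).simple_mul_simple_cancel_left]
      exact h
    · rw [map_mul, hc, bpi_sg, (cs).simple_mul_simple_cancel_left]

lemma H2 {x a a' : M.BraidMonoid} (h : Rd (x * a)) (e : x * a = x * a') : a = a' := by
  apply rd_ext (rd_mul h).2 (rd_mul (e ▸ h)).2
  have := congrArg (bpi M) e
  rw [map_mul, map_mul] at this
  exact mul_left_cancel this

lemma H3 {b : M.BraidMonoid} {i j : B} (hb : Rd b) (hij : i ≠ j) (hi : sg M i ∣ b) (hj : sg M j ∣ b) : M i j ≠ 0 ∧ dl M i j ∣ b := by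
  rw [sg_dvd_iff hb] at hi hj
  obtain ⟨h0, x, hx, hlx⟩ := dih_left cs hij _ hi hj
  refine ⟨h0, ?_⟩
  obtain ⟨y, rfl, hy⟩ := exists_lift x
  refine ⟨y, rd_ext hb ?_ ?_⟩
  · have : bpi M (dl M i j * y) = bpi M b := by rw [map_mul, dl, bpi_mk, hx]
    rw [rd_iff, this, hlx, (rd_iff _).1 hy, blen_mul, dl, blen_mk, length_aw]
  · rw [hx, map_mul, dl, bpi_mk]

lemma H4 {v : M.BraidMonoid} {i j : B} (hij : i ≠ j) (h0 : M i j ≠ 0) (hi : Rd (v * sg M i)) (hj : Rd (v * sg M j)) : Rd (v * dl M i j) := by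
  have hv := (rd_mul hi).1
  rw [rd_mul_sg_iff hv] at hi hj
  have := dih_right cs hij h0 _ hi hj
  rw [rd_iff, map_mul, dl, bpi_mk, this, (rd_iff _).1 hv]; simp

lemma H5 {x : M.BraidMonoid} {i : B} (hx : Rd x) (h : ¬ Rd (sg M i * x)) : sg M i ∣ x := by
  rw [sg_dvd_iff hx]
  rw [rd_sg_mul_iff hx, not_not] at h
  exact h

end basics
end WFN
end partA4

section partA5

namespace WFN
open CoxeterSystem

section joins
variable {B : Type} {M : CoxeterMatrix B}

lemma blen_le_of_dvd {a b : M.BraidMonoid} (h : a ∣ b) : blen a ≤ blen b := by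
  obtain ⟨c, rfl⟩ := h; simp

lemma bsupp_dvd {a b : M.BraidMonoid} (h : a ∣ b) : bsupp a ⊆ bsupp b := by
  obtain ⟨c, rfl⟩ := h; rw [bsupp_mul]; exact Set.subset_union_left

lemma dvd_eq_of_le {a b : M.BraidMonoid} (h : a ∣ b) (h' : blen b ≤ blen a) : a = b := by
  obtain ⟨c, rfl⟩ := h
  rw [blen_mul] at h'
  rw [blen_eq_zero (b := c) (by omega), mul_one]

lemma dvd_anti {a b : M.BraidMonoid} (h : a ∣ b) (h' : b ∣ a) : a = b := 
  dvd_eq_of_le h (blen_le_of_dvd h')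

structure JoinAx (R : M.BraidMonoid → Prop) : Prop where
  h1 : ∀ x y, R (x * y) → R x ∧ R y
  h2 : ∀ x a a', R (x * a) → x * a = x * a' → a = a'
  h3 : ∀ b i j, R b → i ≠ j → sg M i ∣ b → sg M j ∣ b → M i j ≠ 0 ∧ dl M i j ∣ b
  h4 : ∀ v i j, i ≠ j → M i j ≠ 0 → R (v * sg M i) → R (v * sg M j) → R (v * dl M i j)

variable {R : M.BraidMonoid → Prop} (A : JoinAx R)
include A

lemma JoinAx.cancel {a x u : M.BraidMonoid} (h : R (a * u)) (hd : a * x ∣ a * u) : x ∣ u := by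
  obtain ⟨k, hk⟩ := hd
  rw [mul_assoc] at hk
  exact ⟨k, A.h2 _ _ _ h hk⟩

theorem JoinAx.join (n : ℕ) : ∀ b : M.BraidMonoid, blen b ≤ n → R b → ∀ z z', z ∣ b → z' ∣ b → 
    ∃ j, j ∣ b ∧ z ∣ j ∧ z' ∣ j ∧ (∀ u, R u → z ∣ u → z' ∣ u → j ∣ u) ∧ bsupp j ⊆ bsupp z ∪ bsupp z' ∧ 
      ∀ v, R (v * z) → R (v * z') → R (v * j) := by
  induction n with
  | zero =>
    intro b hn hb z z' hz hz'
    obtain rfl := blen_eq_zero (b := b) (by omega)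
    refine ⟨z, hz, dvd_rfl, ?_, fun _ _ h _ => h, Set.subset_union_left, fun _ h _ => h⟩
    rw [blen_eq_zero (b := z') (by have := blen_le_of_dvd hz'; simpa using this)]
    exact one_dvd _
  | succ n ih =>
    intro b hn hb z z' hz hz'
    by_cases hz1 : z = 1
    · subst hz1
      exact ⟨z', hz', one_dvd _, dvd_rfl, fun _ _ _ h => h, Set.subset_union_right, fun _ _ h => h⟩
    by_cases hz1' : z' = 1
    · subst hz1'
      exact ⟨z, hz, dvd_rfl, one_dvd _, fun _ _ h _ => h, Set.subset_union_left, fun _ h _ => h⟩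
    obtain ⟨a, z, rfl⟩ := exists_sg hz1
    obtain ⟨c, z', rfl⟩ := exists_sg hz1'
    obtain ⟨b1, rfl⟩ : ∃ b1, b = sg M a * b1 := (dvd_mul_right _ _).trans hz
    have hb1 : R b1 := (A.h1 _ _ hb).2
    have hn1 : blen b1 ≤ n := by simp at hn; omega
    have hz2 := A.cancel hb hz
    by_cases hac : a = c
    · subst hac
      obtain ⟨j, g1, g2, g3, g4, g5, g6⟩ := ih b1 hn1 hb1 z z' hz2 (A.cancel hb hz')
      refine ⟨sg M a * j, mul_dvd_mul_left _ g1, mul_dvd_mul_left _ g2, mul_dvd_mul_left _ g3, ?_, ?_, ?_⟩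
      · intro u hu k1 k2
        obtain ⟨u, rfl⟩ : ∃ b1, u = sg M a * b1 := (dvd_mul_right _ _).trans k1
        exact mul_dvd_mul_left _ (g4 u (A.h1 _ _ hu).2 (A.cancel hu k1) (A.cancel hu k2))
      · simp only [bsupp_mul]
        intro x hx
        rcases hx with hx | hx
        · exact Or.inl (Or.inl hx)
        · rcases g5 hx with h | h
          · exact Or.inl (Or.inr h)
          · exact Or.inr (Or.inr h)
      · intro v k1 k2
        rw [← mul_assoc] at k1 k2 ⊢
        exact g6 _ k1 k2
    · have hcb := (dvd_mul_right _ _).trans hz'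
      obtain ⟨h0, hdl⟩ := A.h3 _ a c hb hac (dvd_mul_right _ _) hcb
      obtain ⟨δ, hδ⟩ := sg_dvd_dl (M := M) (i := a) (j := c) h0
      obtain ⟨δ', hδ'⟩ := sg_dvd_dl (M := M) (i := c) (j := a) (by rwa [M.symmetric])
      rw [dl_symm] at hδ'
      obtain ⟨b2, hb2⟩ := hcb
      have hRb2 := hb
      rw [hb2] at hRb2
      have hn2 : blen b2 ≤ n := by
        have := congrArg blen hb2
        simp at this; omega
      obtain ⟨p, p1, p2, p3, p4, p5, p6⟩ := ih b1 hn1 hb1 z δ hz2 (A.cancel hb (hδ ▸ hdl))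
      obtain ⟨q, q1, q2, q3, q4, q5, q6⟩ := ih b2 hn2 (A.h1 _ _ hRb2).2 z' δ' (A.cancel hRb2 (hb2 ▸ hz')) (A.cancel hRb2 (hδ' ▸ hb2 ▸ hdl))
      obtain ⟨q', hq'⟩ : sg M a ∣ sg M c * q := by
        refine dvd_trans ?_ (mul_dvd_mul_left _ q3)
        rw [← hδ', hδ]; exact dvd_mul_right _ _
      have hq'b : q' ∣ b1 := by
        apply A.cancel hb
        rw [← hq', hb2]; exact mul_dvd_mul_left _ q1
      obtain ⟨j, g1, g2, g3, g4, g5, g6⟩ := ih b1 hn1 hb1 p q' p1 hq'b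
      refine ⟨sg M a * j, mul_dvd_mul_left _ g1, mul_dvd_mul_left _ (p2.trans g2), ?_, ?_, ?_, ?_⟩
      · refine (mul_dvd_mul_left _ q2).trans ?_
        rw [hq']; exact mul_dvd_mul_left _ g3
      · intro u hu k1 k2
        have hau := (dvd_mul_right _ _).trans k1
        have hcu := (dvd_mul_right _ _).trans k2
        have hdu := (A.h3 _ a c hu hac hau hcu).2
        obtain ⟨u1, hu1⟩ := hau
        obtain ⟨u2, hu2⟩ := hcu
        have e2 : q ∣ u2 := q4 u2 (A.h1 _ _ (hu2 ▸ hu)).2 (A.cancel (hu2 ▸ hu) (hu2 ▸ k2)) (A.cancel (hu2 ▸ hu) (hδ' ▸ hu2 ▸ hdu))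
        have e1 : p ∣ u1 := p4 u1 (A.h1 _ _ (hu1 ▸ hu)).2 (A.cancel (hu1 ▸ hu) (hu1 ▸ k1)) (A.cancel (hu1 ▸ hu) (hδ ▸ hu1 ▸ hdu))
        have e3 : q' ∣ u1 := by
          apply A.cancel (a := sg M a) (hu1 ▸ hu)
          rw [← hq', ← hu1, hu2]; exact mul_dvd_mul_left _ e2
        rw [hu1]
        exact mul_dvd_mul_left _ (g4 u1 (A.h1 _ _ (hu1 ▸ hu)).2 e1 e3)
      · have s1 : bsupp δ ⊆ {a, c} := (bsupp_dl a c).trans' (by rw [hδ, bsupp_mul]; exact Set.subset_union_right)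
        have s2 : bsupp δ' ⊆ {a, c} := (bsupp_dl a c).trans' (by rw [hδ', bsupp_mul]; exact Set.subset_union_right)
        have s3 : bsupp q' ⊆ {c} ∪ bsupp q := by
          have := congrArg bsupp hq'
          rw [bsupp_mul, bsupp_mul, bsupp_sg] at this
          rw [this]; exact Set.subset_union_right
        simp only [bsupp_mul, bsupp_sg]
        have T1 : ({a, c} : Set B) ⊆ {a} ∪ bsupp z ∪ ({c} ∪ bsupp z') := by
          rintro x (rfl | rfl)
          · exact Or.inl (Or.inl rfl)
          · exact Or.inr (Or.inl rfl)
        have T2 : bsupp z ⊆ {a} ∪ bsupp z ∪ ({c} ∪ bsupp z') := fun x hx => Or.inl (Or.inr hx)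
        have T3 : bsupp z' ⊆ {a} ∪ bsupp z ∪ ({c} ∪ bsupp z') := fun x hx => Or.inr (Or.inr hx)
        have T4 : {a} ⊆ {a} ∪ bsupp z ∪ ({c} ∪ bsupp z') := fun x hx => Or.inl (Or.inl hx)
        have T5 : {c} ⊆ {a} ∪ bsupp z ∪ ({c} ∪ bsupp z') := fun x hx => Or.inr (Or.inl hx)
        have T6 := p5.trans (Set.union_subset T2 (s1.trans T1))
        have T7 := q5.trans (Set.union_subset T3 (s2.trans T1))
        have T8 := s3.trans (Set.union_subset T5 T7)
        exact Set.union_subset T4 (g5.trans (Set.union_subset T6 T8))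
      · intro v k1 k2
        have hd : R (v * dl M a c) := by
          apply A.h4 v a c hac h0
          · rw [← mul_assoc] at k1; exact (A.h1 _ _ k1).1
          · rw [← mul_assoc] at k2; exact (A.h1 _ _ k2).1
        rw [← mul_assoc]
        apply g6
        · apply p6
          · rwa [mul_assoc]
          · rwa [mul_assoc, ← hδ]
        · rw [mul_assoc, ← hq', ← mul_assoc]
          apply q6
          · rwa [mul_assoc]
          · rwa [mul_assoc, ← hδ']

theorem JoinAx.greatest (P : M.BraidMonoid → Prop) (w : M.BraidMonoid) (hw : R w) (h1 : P 1) 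
    (hj : ∀ z z' j, P z → P z' → z ∣ w → z' ∣ w → z ∣ j → z' ∣ j → bsupp j ⊆ bsupp z ∪ bsupp z' → 
      (∀ v, R (v * z) → R (v * z') → R (v * j)) → P j) : 
    ∃ z, z ∣ w ∧ P z ∧ ∀ z', z' ∣ w → P z' → z' ∣ z := by
  have key : ∀ n, (∃ z, z ∣ w ∧ P z ∧ blen w ≤ blen z + n) → ∃ z, z ∣ w ∧ P z ∧ ∀ z', z' ∣ w → P z' → z' ∣ z := by
    intro n
    induction n with
    | zero =>
      rintro ⟨z, hz, hp, hl⟩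
      obtain rfl := dvd_eq_of_le hz (by omega)
      exact ⟨z, hz, hp, fun _ h _ => h⟩
    | succ n ih =>
      rintro ⟨z, hz, hp, hl⟩
      by_cases hc : ∀ z', z' ∣ w → P z' → z' ∣ z
      · exact ⟨z, hz, hp, hc⟩
      push Not at hc
      obtain ⟨z', hz', hp', hn⟩ := hc
      obtain ⟨j, g1, g2, g3, g4, g5, g6⟩ := A.join _ w le_rfl hw z z' hz hz'
      apply ih
      refine ⟨j, g1, hj z z' j hp hp' hz hz' g2 g3 g5 g6, ?_⟩
      have : blen z < blen j := by
        by_contra h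
        have := dvd_eq_of_le g2 (by omega)
        subst this
        exact hn g3
      omega
  exact key (blen w) ⟨1, one_dvd _, h1, by simp⟩

end joins

section michel
variable {B : Type} {M : CoxeterMatrix B}

lemma rdAx : JoinAx (M := M) Rd where
  h1 _ _ h := rd_mul h
  h2 _ _ _ h e := H2 h e
  h3 _ _ _ h hij hi hj := H3 h hij hi hj
  h4 _ _ _ hij h0 hi hj := H4 hij h0 hi hj

/-- relation: v sends p to q -/
def Gd (v : M.BraidMonoid) (p q : M.BraidMonoid × M.BraidMonoid) : Prop :=
  ∃ z d, p.1 = z * d ∧ q = (v * z, d * p.2) ∧ Rd (v * z) ∧ ∀ z', z' ∣ p.1 → Rd (v * z') → z' ∣ z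

lemma Gd.exists {v : M.BraidMonoid} (hv : Rd v) {p : M.BraidMonoid × M.BraidMonoid} (hp : Rd p.1) : ∃ q, Gd v p q := by
  obtain ⟨z, ⟨d, hd⟩, h2, h3⟩ := rdAx.greatest (fun z => Rd (v * z)) p.1 hp (by simpa using hv)
    (by intro z z' j k1 k2 _ _ _ _ _ k; exact k v k1 k2)
  exact ⟨_, z, d, hd, rfl, h2, h3⟩

lemma Gd.unique {v : M.BraidMonoid} {p q q' : M.BraidMonoid × M.BraidMonoid} (hp : Rd p.1) (h : Gd v p q) (h' : Gd v p q') : q = q' := by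
  obtain ⟨z, d, h1, rfl, h3, h4⟩ := h
  obtain ⟨z', d', h1', rfl, h3', h4'⟩ := h'
  obtain rfl : z = z' := dvd_anti (h4' z ⟨d, h1⟩ h3) (h4 z' ⟨d', h1'⟩ h3')
  obtain rfl : d = d' := H2 (h1 ▸ hp) (h1.symm.trans h1')
  rfl

lemma Gd.comp {s v : M.BraidMonoid} (h : Rd (s * v)) {p q r : M.BraidMonoid × M.BraidMonoid}
    (hq : Gd v p q) (hr : Gd s q r) : Gd (s * v) p r := by
  obtain ⟨z, d, h1, rfl, h3, h4⟩ := hq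
  obtain ⟨y, e, g1, rfl, g3, g4⟩ := hr
  simp only at g1 g4
  obtain ⟨z1, rfl⟩ : v ∣ y := g4 v (dvd_mul_right _ _) h
  rw [mul_assoc] at g1
  obtain rfl : z = z1 * e := H2 h3 g1
  refine ⟨z1, e * d, by rw [h1, mul_assoc], by simp [mul_assoc], by rwa [mul_assoc], ?_⟩
  intro z' k1 k2
  rw [mul_assoc] at k2
  have k3 := h4 z' k1 (rd_mul k2).2
  have k4 := g4 (v * z') (mul_dvd_mul_left _ k3) k2
  exact rdAx.cancel (rd_mul g3).2 k4

abbrev MS (M : CoxeterMatrix B) := {p : M.BraidMonoid × M.BraidMonoid // Rd p.1}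

lemma ms_exists (i : B) (p : MS M) : ∃ q : MS M, Gd (sg M i) p.1 q.1 := by
  obtain ⟨q, hq⟩ := Gd.exists (rd_sg i) p.2
  refine ⟨⟨q, ?_⟩, hq⟩
  obtain ⟨z, d, h1, rfl, h3, h4⟩ := hq
  exact h3

noncomputable def msAct (M : CoxeterMatrix B) (i : B) : Function.End (MS M) := fun p => (ms_exists i p).choose
lemma msAct_spec (i : B) (p : MS M) : Gd (sg M i) p.1 (msAct M i p).1 := (ms_exists i p).choose_spec

lemma msAct_word (l : List B) (h : Rd (M.braidMk l)) (p : MS M) : Gd (M.braidMk l) p.1 ((l.map (msAct M)).prod p).1 := by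
  induction l with
  | nil =>
    refine ⟨p.1.1, 1, by simp, ?_, ?_, fun z' h _ => h⟩
    · rw [bmk_nil, one_mul, one_mul]; rfl
    · rw [bmk_nil, one_mul]; exact p.2
  | cons a l ih =>
    rw [bmk_cons'] at h ⊢
    exact Gd.comp h (ih (rd_mul h).2) (msAct_spec a _)

lemma rd_aw {i j : B} (hij : i ≠ j) : Rd (M.braidMk (aw i j (M i j))) := ⟨_, rfl, aw_reduced _ hij _ (Or.inr le_rfl)⟩

noncomputable def msH (M : CoxeterMatrix B) : M.BraidMonoid →* Function.End (MS M) := bl (msAct M) (by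
  intro i j
  by_cases hij : i = j
  · subst hij; rfl
  funext p
  apply Subtype.ext
  have h1 := msAct_word _ (rd_aw (M := M) hij) p
  have h2 := msAct_word _ (bmk_aw (M := M) i j ▸ rd_aw (M := M) hij) p
  rw [← bmk_aw] at h2
  exact Gd.unique p.2 h1 h2)

lemma msH_sg (i : B) : msH M (sg M i) = msAct M i := by
  rw [sg, msH, bl_mk]; simp

lemma msH_prod (b : M.BraidMonoid) (p : MS M) : (msH M b p).1.1 * (msH M b p).1.2 = b * (p.1.1 * p.1.2) := by
  obtain ⟨l, rfl⟩ := bmk_surj b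
  induction l with
  | nil => rw [bmk_nil, map_one, one_mul]; rfl
  | cons a l ih =>
    rw [bmk_cons', map_mul, msH_sg, mul_assoc, ← ih]
    change (msAct M a (msH M (M.braidMk l) p)).1.1 * (msAct M a (msH M (M.braidMk l) p)).1.2 = _
    obtain ⟨z, d, h1, h2, -⟩ := msAct_spec a (msH M (M.braidMk l) p)
    rw [h2, h1]; simp [mul_assoc]

noncomputable def st (b : M.BraidMonoid) : MS M := msH M b ⟨(1, 1), rd_one⟩

lemma st_prod (b : M.BraidMonoid) : (st b).1.1 * (st b).1.2 = b := by rw [st, msH_prod]; simp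

lemma st_sg (i : B) (b : M.BraidMonoid) : Gd (sg M i) (st b).1 (st (sg M i * b)).1 := by
  have : st (sg M i * b) = msAct M i (st b) := by rw [st, map_mul, msH_sg]; rfl
  rw [this]; exact msAct_spec i _

lemma sg_cancel {i : B} {b b' : M.BraidMonoid} (h : sg M i * b = sg M i * b') : b = b' := by
  have key : ∀ b : M.BraidMonoid, ∃ z, (st (sg M i * b)).1.1 = sg M i * z ∧ b = z * (st (sg M i * b)).1.2 := by
    intro b
    obtain ⟨z, d, h1, h2, -⟩ := st_sg i b
    refine ⟨z, by rw [h2], ?_⟩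
    rw [h2]
    simp only
    rw [← mul_assoc, ← h1, st_prod]
  obtain ⟨z, hz1, hz2⟩ := key b
  obtain ⟨z', hz1', hz2'⟩ := key b'
  rw [← h] at hz1' hz2'
  have : z = z' := H2 (hz1 ▸ (st (sg M i * b)).2) (hz1.symm.trans hz1')
  rw [hz2, this, ← hz2']

theorem bcancel {a b b' : M.BraidMonoid} (h : a * b = a * b') : b = b' := by
  obtain ⟨l, rfl⟩ := bmk_surj a
  induction l with
  | nil => simpa [bmk_nil] using h
  | cons i l ih => 
    rw [bmk_cons', mul_assoc, mul_assoc] at h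
    exact ih (sg_cancel h)

lemma sg_dvd_st {i : B} {b : M.BraidMonoid} (h : sg M i ∣ b) : sg M i ∣ (st b).1.1 := by
  obtain ⟨c, rfl⟩ := h
  obtain ⟨z, d, h1, h2, -⟩ := st_sg i c
  rw [h2]; exact dvd_mul_right _ _

lemma allAx : JoinAx (M := M) (fun _ => True) where
  h1 _ _ _ := ⟨trivial, trivial⟩
  h2 _ _ _ _ e := bcancel e
  h3 b i j _ hij hi hj := by
    have := H3 (st b).2 hij (sg_dvd_st hi) (sg_dvd_st hj)
    exact ⟨this.1, this.2.trans ⟨_, (st_prod b).symm⟩⟩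
  h4 _ _ _ _ _ _ _ := trivial

lemma dvd_cancel {a x u : M.BraidMonoid} (h : a * x ∣ a * u) : x ∣ u := allAx.cancel trivial h

lemma join_exists {b z z' : M.BraidMonoid} (h : z ∣ b) (h' : z' ∣ b) : 
    ∃ j, z ∣ j ∧ z' ∣ j ∧ (∀ u, z ∣ u → z' ∣ u → j ∣ u) ∧ bsupp j ⊆ bsupp z ∪ bsupp z' := by
  obtain ⟨j, g1, g2, g3, g4, g5, g6⟩ := allAx.join _ b le_rfl trivial z z' h h'
  exact ⟨j, g2, g3, fun u => g4 u trivial, g5⟩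

open Classical in
noncomputable def jn (z z' : M.BraidMonoid) : M.BraidMonoid := 
  if h : ∃ b, z ∣ b ∧ z' ∣ b then (join_exists h.choose_spec.1 h.choose_spec.2).choose else 1

lemma jn_spec {b z z' : M.BraidMonoid} (h : z ∣ b) (h' : z' ∣ b) : 
    z ∣ jn z z' ∧ z' ∣ jn z z' ∧ (∀ u, z ∣ u → z' ∣ u → jn z z' ∣ u) ∧ bsupp (jn z z') ⊆ bsupp z ∪ bsupp z' := by
  have hh : ∃ b, z ∣ b ∧ z' ∣ b := ⟨b, h, h'⟩
  rw [jn, dif_pos hh]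
  exact (join_exists hh.choose_spec.1 hh.choose_spec.2).choose_spec

/-- left quotient -/
noncomputable def lq (a b : M.BraidMonoid) : M.BraidMonoid := open Classical in if h : a ∣ b then h.choose else 1
lemma mul_lq {a b : M.BraidMonoid} (h : a ∣ b) : a * lq a b = b := by
  rw [lq, dif_pos h]; exact h.choose_spec.symm
lemma lq_mul (a b : M.BraidMonoid) : lq a (a * b) = b := bcancel (mul_lq (dvd_mul_right a b))

lemma A6 {x z : M.BraidMonoid} (hz : Rd z) (h : ¬ Rd (x * z)) : 
    ∃ z', z' ∣ z ∧ bsupp z' ⊆ bsupp x ∧ ¬ Rd (x * z') := by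
  obtain ⟨l, rfl⟩ := bmk_surj x
  induction l with
  | nil => exact absurd (by rwa [bmk_nil, one_mul]) h
  | cons i l ih =>
    rw [bmk_cons', mul_assoc] at h
    by_cases hl : Rd (M.braidMk l * z)
    · have hd := H5 hl h
      obtain ⟨j1, j2, j3, j4⟩ := jn_spec hd (dvd_mul_right (M.braidMk l) z)
      obtain ⟨z', hz'⟩ := j2
      refine ⟨z', ?_, ?_, ?_⟩
      · have := j3 _ hd (dvd_mul_right _ _)
        rw [hz'] at this
        exact dvd_cancel this
      · rw [hz', bsupp_mul] at j4
        rw [bmk_cons', bsupp_mul]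
        exact Set.subset_union_right.trans j4
      · intro hR
        rw [bmk_cons', mul_assoc, ← hz'] at hR
        obtain ⟨y, hy⟩ := j1
        have h1 := (rd_mul hR).2
        rw [rd_sg_mul_iff h1] at hR
        exact hR ((sg_dvd_iff h1).1 ⟨y, hy⟩)
    · obtain ⟨z', k1, k2, k3⟩ := ih hl
      refine ⟨z', k1, ?_, ?_⟩
      · rw [bmk_cons', bsupp_mul]; exact k2.trans Set.subset_union_right
      · intro hR
        rw [bmk_cons', mul_assoc] at hR
        exact k3 (rd_mul hR).2

end michel
end WFN
end partA5

section partA6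

namespace WFN
open CoxeterSystem

section subs
open scoped Pointwise
variable {B : Type} {M : CoxeterMatrix B}
local notation "cs" => M.toCoxeterSystem

lemma shorten (k : ℕ) : ∀ (i j : B) (l : List B), (∀ a ∈ l, a = i ∨ a = j) → l.length = k → (∀ a l', l = a :: l' → a = i) → 
    l = aw i j k ∨ ∃ l' : List B, (∀ a ∈ l', a = i ∨ a = j) ∧ l'.length < k ∧ (cs).wordProd l = (cs).wordProd l' := by
  induction k with
  | zero => intro i j l _ h _; left; simpa using h
  | succ k ih =>
    intro i j l hl hlen hst
    obtain ⟨a, l, rfl⟩ : ∃ a l', l = a :: l' := List.exists_cons_of_length_eq_add_one hlen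
    obtain rfl := hst a l rfl
    have hl1 : ∀ x ∈ l, x = j ∨ x = a := fun x hx => (hl x (List.mem_cons_of_mem _ hx)).symm
    by_cases hh : ∀ c l', l = c :: l' → c = j
    · rcases ih j a l hl1 (by simpa using hlen) hh with h | ⟨l', h1, h2, h3⟩
      · left; rw [aw_succ, h]
      · right
        refine ⟨a :: l', ?_, by simp; omega, by rw [(cs).wordProd_cons, (cs).wordProd_cons, h3]⟩
        intro x hx
        rcases List.mem_cons.1 hx with h | h
        · exact Or.inl h
        · exact (h1 x h).symm
    · push Not at hh
      obtain ⟨c, l', rfl, hc⟩ := hh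
      right
      obtain rfl : c = a := (hl1 c (by simp)).resolve_left hc
      refine ⟨l', fun x hx => hl x (by simp [hx]), by simp at hlen; omega, ?_⟩
      rw [(cs).wordProd_cons, (cs).wordProd_cons, (cs).simple_mul_simple_cancel_left]

lemma sub_aw (k : ℕ) : ∀ (i j : B), ((aw i j k).map (fun s => ({1, (cs).simple s} : Set M.Group))).prod = 
    {w | ∃ l : List B, (∀ a ∈ l, a = i ∨ a = j) ∧ l.length < k ∧ w = (cs).wordProd l} ∪ {(cs).wordProd (aw i j k)} := by
  induction k with
  | zero => intro i j; simp ; rfl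
  | succ k ih =>
    intro i j
    rw [aw_succ, List.map_cons, List.prod_cons, ih]
    ext w
    rw [Set.mem_mul]
    constructor
    · rintro ⟨x, hx, y, hy, rfl⟩
      rcases hx with rfl | rfl <;> rcases hy with ⟨l, h1, h2, rfl⟩ | rfl
      · left; exact ⟨l, fun a ha => (h1 a ha).symm, by omega, by simp⟩
      · left; exact ⟨aw j i k, fun a ha => (mem_aw ha).symm, by simp, by simp⟩
      · left; refine ⟨i :: l, ?_, by simpa using h2, by rw [(cs).wordProd_cons]⟩
        intro x hx
        rcases List.mem_cons.1 hx with h | h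
        · exact Or.inl h
        · exact (h1 x h).symm
      · right; rw [Set.mem_singleton_iff, (cs).wordProd_cons]
    · rintro (⟨l, h1, h2, rfl⟩ | h)
      · by_cases hl : l.length < k
        · exact ⟨1, Or.inl rfl, _, Or.inl ⟨l, fun a ha => (h1 a ha).symm, hl, rfl⟩, by simp⟩
        by_cases hh : ∀ c l', l = c :: l' → c = j
        · rcases shorten (M := M) k j i l (fun a ha => (h1 a ha).symm) (by omega) hh with h | ⟨l', g1, g2, g3⟩
          · exact ⟨1, Or.inl rfl, _, Or.inr rfl, by simp [h]⟩
          · exact ⟨1, Or.inl rfl, _, Or.inl ⟨l', g1, g2, rfl⟩, by rw [one_mul, g3]⟩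
        · push Not at hh
          obtain ⟨c, l', rfl, hc⟩ := hh
          obtain rfl : c = i := (h1 c (by simp)).resolve_right hc
          refine ⟨_, Or.inr rfl, _, Or.inl ⟨l', fun a ha => (h1 a (by simp [ha])).symm, by simpa using h2, rfl⟩, by rw [(cs).wordProd_cons]⟩
      · rw [Set.mem_singleton_iff, (cs).wordProd_cons] at h
        exact ⟨_, Or.inr rfl, _, Or.inr rfl, h.symm⟩

noncomputable def subH (M : CoxeterMatrix B) : M.BraidMonoid →* Set M.Group := bl (fun s => ({1, M.toCoxeterSystem.simple s} : Set M.Group)) (by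
  intro i j
  rw [sub_aw, sub_aw, aw_braid]
  congr 1
  ext w
  constructor
  · rintro ⟨l, h1, h2⟩; exact ⟨l, fun a ha => (h1 a ha).symm, h2⟩
  · rintro ⟨l, h1, h2⟩; exact ⟨l, fun a ha => (h1 a ha).symm, h2⟩)

lemma subH_sg (i : B) : subH M (sg M i) = {1, (cs).simple i} := by rw [subH, sg, bl_mk, List.map_singleton, List.prod_singleton]

lemma subH_fin (b : M.BraidMonoid) : (subH M b).Finite ∧ 1 ∈ subH M b := by
  obtain ⟨l, rfl⟩ := bmk_surj b
  induction l with
  | nil => rw [bmk_nil, map_one]; simp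
  | cons a l ih =>
    rw [bmk_cons', map_mul, subH_sg]
    exact ⟨Set.Finite.mul (by simp) ih.1, Set.mem_mul.2 ⟨1, by simp, 1, ih.2, by simp⟩⟩

theorem ft_of_dvd {J : Set B} {m : M.BraidMonoid} (h : ∀ i ∈ J, sg M i ∣ m) : FT M J := by
  have key : Subgroup.closure (M.simple '' J) ≤ MulAction.stabilizer M.Group (subH M m) := by
    rw [Subgroup.closure_le]
    rintro _ ⟨i, hi, rfl⟩
    rw [SetLike.mem_coe, MulAction.mem_stabilizer_iff]
    obtain ⟨c, rfl⟩ := h i hi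
    rw [map_mul, subH_sg, ← smul_mul_assoc]
    congr 1
    have e : M.simple i * (cs).simple i = 1 := (cs).simple_mul_simple_self i
    rw [Set.smul_set_insert, Set.smul_set_singleton, smul_eq_mul, smul_eq_mul, e, mul_one]
    exact Set.pair_comm _ _
  refine Set.Finite.subset (subH_fin m).1 ?_
  intro g hg
  have h1 := key hg
  rw [MulAction.mem_stabilizer_iff] at h1
  rw [← h1]
  exact ⟨1, (subH_fin m).2, by simp⟩

/-- atoms dividing d -/
def atoms (d : M.BraidMonoid) : Set B := {i | sg M i ∣ d}

lemma jd_exists (d : M.BraidMonoid) : ∃ z, z ∣ d ∧ bsupp z ⊆ atoms d ∧ ∀ z', z' ∣ d → bsupp z' ⊆ atoms d → z' ∣ z :=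
  allAx.greatest (fun z => bsupp z ⊆ atoms d) d trivial (by simp) 
    (fun z z' j h h' _ _ _ _ hs _ => hs.trans (Set.union_subset h h'))

noncomputable def jd (d : M.BraidMonoid) : M.BraidMonoid := (jd_exists d).choose

lemma jd_dvd (d : M.BraidMonoid) : jd d ∣ d := (jd_exists d).choose_spec.1
lemma jd_mono {d d' : M.BraidMonoid} (h : d ∣ d') : jd d ∣ jd d' := by
  apply (jd_exists d').choose_spec.2.2 _ ((jd_dvd d).trans h)
  exact (jd_exists d).choose_spec.2.1.trans (fun i hi => dvd_trans hi h)
lemma jd_ft (d : M.BraidMonoid) : FT M (bsupp (jd d)) := 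
  ft_of_dvd (m := d) (fun _ hi => (jd_exists d).choose_spec.2.1 hi)
lemma jd_ne {d : M.BraidMonoid} (h : d ≠ 1) : jd d ≠ 1 := by
  obtain ⟨i, c, rfl⟩ := exists_sg h
  have h1 : sg M i ∣ jd (sg M i * c) := by
    apply (jd_exists _).choose_spec.2.2
    · exact dvd_mul_right _ _
    · rw [bsupp_sg]; rintro x rfl; exact dvd_mul_right _ _
  rw [ne_one_iff]
  have := blen_le_of_dvd h1
  rw [blen_sg] at this; omega

end subs
end WFN
end partA6

section partC1

namespace WFN
open CoxeterSystem

section refine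
variable {N : Type} [Monoid N]

/-- refinement of lists -/
inductive Rf : List N → List N → Prop
  | nil : Rf [] []
  | cons (u : List N) {v w : List N} (h : Rf v w) : Rf (u ++ v) (u.prod :: w)

lemma Rf.refl (v : List N) : Rf v v := by
  induction v with
  | nil => exact Rf.nil
  | cons a v ih => simpa using Rf.cons [a] ih

lemma Rf.prod_eq {v w : List N} (h : Rf v w) : v.prod = w.prod := by
  induction h with
  | nil => rfl
  | cons u h ih => simp [ih]

lemma Rf.cons_inv {v w : List N} {a : N} (h : Rf v (a :: w)) : ∃ u v', v = u ++ v' ∧ a = u.prod ∧ Rf v' w := by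
  cases h with
  | cons u h => exact ⟨u, _, rfl, rfl, h⟩

lemma Rf.nil_inv {v : List N} (h : Rf v []) : v = [] := by cases h; rfl

lemma Rf.split {w1 w2 : List N} : ∀ {v : List N}, Rf v (w1 ++ w2) → ∃ v1 v2, v = v1 ++ v2 ∧ Rf v1 w1 ∧ Rf v2 w2 := by
  induction w1 with
  | nil => intro v h; exact ⟨[], v, rfl, Rf.nil, h⟩
  | cons a w1 ih =>
    intro v h
    obtain ⟨u, v', rfl, rfl, h'⟩ := Rf.cons_inv h
    obtain ⟨v1, v2, rfl, h1, h2⟩ := ih h'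
    exact ⟨u ++ v1, v2, by simp, Rf.cons u h1, h2⟩

lemma Rf.trans {u v w : List N} (h : Rf u v) (h' : Rf v w) : Rf u w := by
  induction h' generalizing u with
  | nil => exact h
  | cons a h' ih =>
    obtain ⟨v1, v2, rfl, h1, h2⟩ := Rf.split h
    rw [← h1.prod_eq]
    exact Rf.cons v1 (ih h2)

lemma Rf.iff (v w : List N) : Rf v w ↔ ListRefines v w := by
  constructor
  · intro h
    induction h with
    | nil => exact ⟨[], rfl, rfl⟩
    | cons u h ih =>
      obtain ⟨L, rfl, rfl⟩ := ih
      exact ⟨u :: L, by simp, by simp⟩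
  · rintro ⟨L, rfl, rfl⟩
    induction L with
    | nil => exact Rf.nil
    | cons u L ih => simpa using Rf.cons u ih

/-- order on raw data -/
def rle {Λ : Type} [Preorder Λ] (t t' : Λ × N × List N) : Prop :=
  t.1 ≤ t'.1 ∧ ∃ u v, t.2.2 = u ++ v ∧ t'.2.1 = t.2.1 * u.prod ∧ Rf v t'.2.2

lemma rle_refl {Λ : Type} [Preorder Λ] (t : Λ × N × List N) : rle t t := ⟨le_rfl, [], t.2.2, rfl, by simp, Rf.refl _⟩

lemma rle_trans {Λ : Type} [Preorder Λ] {a b c : Λ × N × List N} (h : rle a b) (h' : rle b c) : rle a c := by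
  obtain ⟨h1, u, v, h2, h3, h4⟩ := h
  obtain ⟨g1, u', v', g2, g3, g4⟩ := h'
  rw [g2] at h4
  obtain ⟨v1, v2, rfl, k1, k2⟩ := Rf.split h4
  refine ⟨h1.trans g1, u ++ v1, v2, by rw [h2]; simp, ?_, k2.trans g4⟩
  rw [g3, h3, List.prod_append, k1.prod_eq, mul_assoc]

end refine

section comb
set_option linter.unusedSectionVars false
variable {B : Type} {M : CoxeterMatrix B}

lemma mul_eq_one_left {a b : M.BraidMonoid} (h : a * b = 1) : a = 1 := by
  have := congrArg blen h
  rw [blen_mul, blen_one] at this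
  exact blen_eq_zero (by omega)
lemma mul_eq_one_right {a b : M.BraidMonoid} (h : a * b = 1) : b = 1 := by
  have := congrArg blen h
  rw [blen_mul, blen_one] at this
  exact blen_eq_zero (by omega)

lemma list_prod_one {u : List M.BraidMonoid} (hu : ∀ x ∈ u, x ≠ 1) (h : u.prod = 1) : u = [] := by
  cases u with
  | nil => rfl
  | cons a u => 
    rw [List.prod_cons] at h
    exact absurd (mul_eq_one_left h) (hu a (by simp))

lemma rd_list {u : List M.BraidMonoid} (h : Rd u.prod) : ∀ x ∈ u, Rd x := by
  induction u with
  | nil => simp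
  | cons a u ih =>
    rw [List.prod_cons] at h
    intro x hx
    rcases List.mem_cons.1 hx with rfl | hx
    · exact (rd_mul h).1
    · exact ih (rd_mul h).2 x hx

structure Sys (M : CoxeterMatrix B) (Λ : Type) [Preorder Λ] [OrderBot Λ] where
  K : Λ → Set B
  N : Λ → Set M.BraidMonoid
  Kmono : ∀ {a b}, a ≤ b → K a ⊆ K b
  Nmono : ∀ {a b}, a ≤ b → N a ⊆ N b
  Nmul : ∀ a c d, c ∈ N a → c * d ∈ N a
  Nnr : ∀ a c, ¬ Rd c → c ∈ N a
  ft : FT M (K ⊥)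
  Al : Λ → Prop
  Alb : Al ⊥

variable {Λ : Type} [Preorder Λ] [OrderBot Λ] 

structure Ok (S : Sys M Λ) (y : M.BraidMonoid) (t : Λ × M.BraidMonoid × List M.BraidMonoid) : Prop where
  hp : t.2.1 * t.2.2.prod = y
  hne : ∀ x ∈ t.2.2, x ≠ 1
  hft : ∀ x ∈ t.2.2, FT M (bsupp x)
  hK : FT M (S.K t.1 ∪ bsupp t.2.1)
  hN : t.2.1 ∈ S.N t.1 ∨ ∃ x ∈ t.2.2, ¬ Rd x
  hA : S.Al t.1

def YY (S : Sys M Λ) (y : M.BraidMonoid) : Type := {t : Λ × M.BraidMonoid × List M.BraidMonoid // Ok S y t}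

instance (S : Sys M Λ) (y : M.BraidMonoid) : Preorder (YY S y) where
  le p q := rle p.1 q.1
  le_refl p := rle_refl p.1
  le_trans _ _ _ h h' := rle_trans h h'

def Df (y : M.BraidMonoid) : Type := {d : M.BraidMonoid // d ≠ 1 ∧ d ∣ y ∧ FT M (bsupp d)}

instance (y : M.BraidMonoid) : Preorder (Df y) where
  le p q := p.1 ∣ q.1
  le_refl p := dvd_rfl
  le_trans _ _ _ h h' := dvd_trans h h'

lemma good_Df {y : M.BraidMonoid} (hy : y ≠ 1) : Good (Df y) := by
  refine good_zigzag (fun d : Df y => (⟨jd d.1, jd_ne d.2.1, (jd_dvd _).trans d.2.2.1, jd_ft _⟩ : Df y)) ?_ 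
    (⟨jd y, jd_ne hy, jd_dvd y, jd_ft y⟩ : Df y) (Or.inr ?_)
  · intro d d' h; exact jd_mono h
  · intro d; exact ⟨jd_dvd d.1, jd_mono d.2.2.1⟩

/-- extended system -/
def Sys.ext (S : Sys M Λ) (x : M.BraidMonoid) (hx : FT M (bsupp x)) : Sys M (Λ × Bool) where
  K p := if p.2 then S.K p.1 ∪ bsupp x else bsupp x
  N p := if p.2 then {c | x * c ∈ S.N p.1} else {c | ¬ Rd (x * c) ∨ 1 ∈ S.N p.1}
  Kmono := by
    rintro ⟨a, _ | _⟩ ⟨b, _ | _⟩ ⟨h, h'⟩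
    · simp
    · simp
    · exact absurd (show true ≤ false from h') (by decide)
    · simpa using (S.Kmono h).trans Set.subset_union_left
  Nmono := by
    rintro ⟨a, _ | _⟩ ⟨b, _ | _⟩ ⟨h, h'⟩ c hc
    · simp at hc ⊢
      exact hc.imp id (fun h1 => S.Nmono h h1)
    · simp at hc ⊢
      rcases hc with hc | hc
      · exact S.Nnr _ _ hc
      · have := S.Nmul _ _ (x * c) (S.Nmono h hc)
        rwa [one_mul] at this
    · exact absurd (show true ≤ false from h') (by decide)
    · simp at hc ⊢
      exact S.Nmono h hc
  Nmul := by
    rintro ⟨a, _ | _⟩ c d hc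
    · simp at hc ⊢
      refine hc.imp (fun h h1 => h ?_) id
      rw [← mul_assoc] at h1; exact (rd_mul h1).1
    · simp at hc ⊢
      rw [← mul_assoc]; exact S.Nmul _ _ _ hc
  Nnr := by
    rintro ⟨a, _ | _⟩ c hc
    · simp; left; intro h; exact hc (rd_mul h).2
    · simp; exact S.Nnr _ _ (fun h => hc (rd_mul h).2)
  ft := by
    change FT M (bsupp x); exact hx
  Al p := S.Al p.1 ∧ (p.2 = false → FT M (S.K p.1))
  Alb := ⟨S.Alb, fun _ => S.ft⟩

open Classical in
noncomputable def fst' (t : Λ × M.BraidMonoid × List M.BraidMonoid) : M.BraidMonoid :=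
  if t.2.1 = 1 then t.2.2.headD 1 else t.2.1

lemma fst_one (l : Λ) (a : M.BraidMonoid) (w) : fst' (l, 1, a :: w) = a := by simp [fst']
lemma fst_ne (l : Λ) (c : M.BraidMonoid) (h : c ≠ 1) (w) : fst' (l, c, w) = c := by simp [fst', h]

lemma Ok.cases {S : Sys M Λ} {y : M.BraidMonoid} (hy : y ≠ 1) {t} (h : Ok S y t) : 
    (∃ l c w, t = (l, c, w) ∧ c ≠ 1) ∨ (∃ l a w, t = (l, 1, a :: w) ∧ a ≠ 1) := by
  obtain ⟨l, c, w⟩ := t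
  by_cases hc : c = 1
  · subst hc
    cases w with
    | nil => exact absurd (by simpa using h.hp.symm) hy
    | cons a w => exact Or.inr ⟨l, a, w, rfl, h.hne a (by simp)⟩
  · exact Or.inl ⟨l, c, w, rfl, hc⟩

lemma fst_mem {S : Sys M Λ} {y : M.BraidMonoid} (hy : y ≠ 1) {t} (h : Ok S y t) : fst' t ≠ 1 ∧ fst' t ∣ y ∧ FT M (bsupp (fst' t)) := by
  rcases h.cases hy with ⟨l, c, w, rfl, hc⟩ | ⟨l, a, w, rfl, ha⟩
  · rw [fst_ne _ _ hc]
    exact ⟨hc, ⟨_, h.hp.symm⟩, h.hK.mono Set.subset_union_right⟩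
  · rw [fst_one]
    refine ⟨ha, ⟨w.prod, ?_⟩, h.hft a (by simp)⟩
    rw [← h.hp]; simp

/-- comparison of elements with trivial first entry -/
lemma rle_one {S : Sys M Λ} {y : M.BraidMonoid} {l a w l' c' w'} (h : Ok S y (l, 1, a :: w)) (h' : Ok S y (l', c', w')) 
    (hle : rle (l, 1, a :: w) (l', c', w')) : l ≤ l' ∧ 
      ((c' = 1 ∧ ∃ u v w'', w = u ++ v ∧ w' = (a * u.prod) :: w'' ∧ Rf v w'') ∨ (c' ≠ 1 ∧ ∃ u v, w = u ++ v ∧ c' = a * u.prod ∧ Rf v w')) := by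
  obtain ⟨h1, u, v, h2, h3, h4⟩ := hle
  refine ⟨h1, ?_⟩
  simp only [one_mul] at h2 h3 h4
  have hne := h.hne
  simp only at hne
  cases u with
  | nil =>
    left
    refine ⟨by simpa using h3, ?_⟩
    simp only [List.nil_append] at h2
    subst h2
    cases w' with
    | nil => have := h4.nil_inv; simp at this
    | cons b w' =>
      obtain ⟨u, v, e1, e2, e3⟩ := h4.cons_inv
      cases u with
      | nil => exact absurd (by simpa using e2) (h'.hne b (by simp))
      | cons d u =>
        simp only [List.cons_append, List.cons.injEq] at e1
        obtain ⟨rfl, rfl⟩ := e1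
        exact ⟨u, v, w', rfl, by rw [e2, List.prod_cons], e3⟩
  | cons d u =>
    right
    simp only [List.cons_append, List.cons.injEq] at h2
    obtain ⟨rfl, rfl⟩ := h2
    rw [List.prod_cons] at h3
    exact ⟨fun hc => hne a (by simp) (mul_eq_one_left (h3.symm.trans hc)), u, v, rfl, h3, h4⟩

lemma fst_mono {S : Sys M Λ} {y : M.BraidMonoid} (hy : y ≠ 1) {t t'} (h : Ok S y t) (h' : Ok S y t') (hle : rle t t') : fst' t ∣ fst' t' := by
  rcases h.cases hy with ⟨l, c, w, rfl, hc⟩ | ⟨l, a, w, rfl, ha⟩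
  · obtain ⟨l', c', w'⟩ := t'
    obtain ⟨h1, u, v, h2, h3, h4⟩ := hle
    simp only at h3
    subst h3
    rw [fst_ne _ _ hc, fst_ne _ _ (fun e => hc (mul_eq_one_left e))]
    exact dvd_mul_right _ _
  · obtain ⟨l', c', w'⟩ := t'
    obtain ⟨-, ⟨rfl, u, v, w'', rfl, rfl, -⟩ | ⟨hc, u, v, rfl, rfl, -⟩⟩ := rle_one h h' hle
    · rw [fst_one, fst_one]; exact dvd_mul_right _ _
    · rw [fst_one, fst_ne _ _ hc]; exact dvd_mul_right _ _

/-- fibre map, raw -/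
noncomputable def fF (x : M.BraidMonoid) (t : Λ × M.BraidMonoid × List M.BraidMonoid) : (Λ × Bool) × M.BraidMonoid × List M.BraidMonoid :=
  open Classical in if t.2.1 = 1 then ((t.1, false), lq x (t.2.2.headD 1), t.2.2.tail) else ((t.1, true), lq x t.2.1, t.2.2)

noncomputable def gF (x : M.BraidMonoid) (t : (Λ × Bool) × M.BraidMonoid × List M.BraidMonoid) : Λ × M.BraidMonoid × List M.BraidMonoid :=
  if t.1.2 then (t.1.1, x * t.2.1, t.2.2) else (t.1.1, 1, (x * t.2.1) :: t.2.2)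

lemma fF_one (x : M.BraidMonoid) (l : Λ) (c w) : fF x (l, 1, (x * c) :: w) = ((l, false), c, w) := by simp [fF, lq_mul]
lemma fF_ne {x : M.BraidMonoid} (hx : x ≠ 1) (l : Λ) (c w) : fF x (l, x * c, w) = ((l, true), c, w) := by
  have : x * c ≠ 1 := fun e => hx (mul_eq_one_left e)
  simp [fF, this, lq_mul]

lemma fib_cases {S : Sys M Λ} {y x : M.BraidMonoid} (hy : y ≠ 1) {t} (h : Ok S y t) (hx : x ∣ fst' t) :
    (∃ l c w, t = (l, x * c, w)) ∨ (∃ l c w, t = (l, 1, (x * c) :: w)) := by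
  rcases h.cases hy with ⟨l, c, w, rfl, hc⟩ | ⟨l, a, w, rfl, ha⟩
  · rw [fst_ne _ _ hc] at hx; obtain ⟨d, rfl⟩ := hx; exact Or.inl ⟨l, d, w, rfl⟩
  · rw [fst_one] at hx; obtain ⟨d, rfl⟩ := hx; exact Or.inr ⟨l, d, w, rfl⟩

lemma fF_ok {S : Sys M Λ} {y x : M.BraidMonoid} (hy : y ≠ 1) (hx1 : x ≠ 1) (hxf) {t} (h : Ok S y t) (hx : x ∣ fst' t) :
    Ok (S.ext x hxf) (lq x y) (fF x t) := by
  rcases fib_cases hy h hx with ⟨l, c, w, rfl⟩ | ⟨l, c, w, rfl⟩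
  · rw [fF_ne hx1]
    refine ⟨?_, h.hne, h.hft, ?_, ?_, ⟨h.hA, by simp⟩⟩
    · rw [← h.hp]; simp only; rw [mul_assoc, lq_mul]
    · have := h.hK
      simpa [Sys.ext, bsupp_mul, Set.union_assoc] using this
    · simpa [Sys.ext] using h.hN
  · rw [fF_one]
    refine ⟨?_, fun z hz => h.hne z (by simp at hz ⊢; tauto), fun z hz => h.hft z (by simp at hz ⊢; tauto), ?_, ?_, ⟨h.hA, fun _ => h.hK.mono Set.subset_union_left⟩⟩
    · rw [← h.hp]; simp only [one_mul, List.prod_cons]; rw [mul_assoc, lq_mul]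
    · have := h.hft (x * c) (by simp)
      simpa [Sys.ext, bsupp_mul] using this
    · have := h.hN
      simp [Sys.ext] at this ⊢
      tauto

lemma gF_ok {S : Sys M Λ} {y x : M.BraidMonoid} (hx1 : x ≠ 1) (hxf) (hxy : x ∣ y) {t} (h : Ok (S.ext x hxf) (lq x y) t) : 
    Ok S y (gF x t) ∧ x ∣ fst' (gF x t) := by
  obtain ⟨y, rfl⟩ := hxy
  rw [lq_mul] at h
  have hx2 : ∀ c, x * c ≠ 1 := fun c e => hx1 (mul_eq_one_left e)
  obtain ⟨⟨l, _ | _⟩, c, w⟩ := t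
  · have e : gF x ((l, false), c, w) = (l, 1, (x * c) :: w) := by simp [gF]
    rw [e, fst_one]
    have hK := h.hK
    have hN := h.hN
    have hp := h.hp
    have hft := h.hft
    simp [Sys.ext] at hK hN hp hft
    refine ⟨⟨?_, ?_, ?_, ?_, ?_, h.hA.1⟩, dvd_mul_right _ _⟩
    · simp [← hp, mul_assoc]
    · intro z hz
      rcases List.mem_cons.1 hz with rfl | hz
      · exact hx2 c
      · exact h.hne z hz
    · intro z hz
      rcases List.mem_cons.1 hz with rfl | hz
      · rw [bsupp_mul]; exact hK
      · exact hft z hz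
    · simpa using h.hA.2 rfl
    · simp
      tauto
  · have e : gF x ((l, true), c, w) = (l, x * c, w) := by simp [gF]
    rw [e, fst_ne _ _ (hx2 c)]
    have hK := h.hK
    have hN := h.hN
    have hp := h.hp
    simp [Sys.ext] at hK hN hp
    refine ⟨⟨?_, h.hne, h.hft, ?_, ?_, h.hA.1⟩, dvd_mul_right _ _⟩
    · simp [← hp, mul_assoc]
    · rw [Set.union_assoc] at hK; simpa [bsupp_mul] using hK
    · simpa using hN

end comb
end WFN
end partC1

section partC2

namespace WFN
open CoxeterSystem

section final
set_option linter.unusedSectionVars false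
variable {B : Type} {M : CoxeterMatrix B}
variable {Λ : Type} [Preorder Λ] [OrderBot Λ] 

lemma fF_mono {S : Sys M Λ} {y x : M.BraidMonoid} (hy : y ≠ 1) (hx1 : x ≠ 1) {t t'} (h : Ok S y t) (h' : Ok S y t')
    (hx : x ∣ fst' t) (hx' : x ∣ fst' t') (hle : rle t t') : rle (fF x t) (fF x t') := by
  have hx2 : ∀ c, x * c ≠ 1 := fun c e => hx1 (mul_eq_one_left e)
  rcases fib_cases hy h hx with ⟨l, c, w, rfl⟩ | ⟨l, c, w, rfl⟩
  · rcases fib_cases hy h' hx' with ⟨l', c', w', rfl⟩ | ⟨l', c', w', rfl⟩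
    · rw [fF_ne hx1, fF_ne hx1]
      obtain ⟨h1, u, v, h2, h3, h4⟩ := hle
      refine ⟨⟨h1, le_rfl⟩, u, v, h2, ?_, h4⟩
      simp only [mul_assoc] at h3
      exact bcancel h3
    · obtain ⟨h1, u, v, h2, h3, h4⟩ := hle
      exact absurd (mul_eq_one_left h3.symm) (hx2 c)
  · rcases fib_cases hy h' hx' with ⟨l', c', w', rfl⟩ | ⟨l', c', w', rfl⟩
    · rw [fF_one, fF_ne hx1]
      obtain ⟨h1, ⟨h2, -⟩ | ⟨-, u, v, rfl, h3, h4⟩⟩ := rle_one h h' hle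
      · exact absurd h2 (hx2 _)
      · refine ⟨⟨h1, show false ≤ true by decide⟩, u, v, rfl, ?_, h4⟩
        rw [mul_assoc] at h3
        exact bcancel h3
    · rw [fF_one, fF_one]
      obtain ⟨h1, ⟨-, u, v, w'', rfl, h3, h4⟩ | ⟨h2, -⟩⟩ := rle_one h h' hle
      · simp only [List.cons.injEq] at h3
        obtain ⟨h3, rfl⟩ := h3
        refine ⟨⟨h1, le_rfl⟩, u, v, rfl, ?_, h4⟩
        rw [mul_assoc] at h3
        exact bcancel h3
      · exact absurd rfl h2

lemma gF_mono {x : M.BraidMonoid} {t t' : (Λ × Bool) × M.BraidMonoid × List M.BraidMonoid} (hle : rle t t') : rle (gF x t) (gF x t') := by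
  obtain ⟨⟨l, e⟩, c, w⟩ := t
  obtain ⟨⟨l', e'⟩, c', w'⟩ := t'
  obtain ⟨⟨h1, h1'⟩, u, v, h2, h3, h4⟩ := hle
  simp only at h1 h1' h2 h3 h4
  subst h2 h3
  cases e <;> cases e'
  · refine ⟨h1, [], (x * c) :: (u ++ v), rfl, by simp [gF], ?_⟩
    have := Rf.cons (x * c :: u) h4
    simpa [gF, mul_assoc] using this
  · exact ⟨h1, x * c :: u, v, rfl, by simp [gF, mul_assoc], h4⟩
  · exact absurd h1' (by decide)
  · exact ⟨h1, u, v, rfl, by simp [gF, mul_assoc], h4⟩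

lemma gF_fF {S : Sys M Λ} {y x : M.BraidMonoid} (hy : y ≠ 1) (hx1 : x ≠ 1) {t} (h : Ok S y t) (hx : x ∣ fst' t) : gF x (fF x t) = t := by
  rcases fib_cases hy h hx with ⟨l, c, w, rfl⟩ | ⟨l, c, w, rfl⟩
  · rw [fF_ne hx1]; simp [gF]
  · rw [fF_one]; simp [gF]

theorem step (S : Sys M Λ) (y : M.BraidMonoid) (hy : y ≠ 1) 
    (H : ∀ x (hx : FT M (bsupp x)), x ≠ 1 → x ∣ y → Good (YY (S.ext x hx) (lq x y))) : Good (YY S y) := by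
  refine quillen (Q := Df y) (fun p : YY S y => (⟨fst' p.1, fst_mem hy p.2⟩ : Df y)) ?_ (good_Df hy) ?_
  · intro p q h; exact fst_mono hy p.2 q.2 h
  · rintro ⟨x, hx1, hx2, hx3⟩
    refine good_retract (Q := YY (S.ext x hx3) (lq x y)) (fun p => (⟨fF x p.1.1, fF_ok hy hx1 hx3 p.1.2 p.2⟩ : YY (S.ext x hx3) (lq x y))) ?_ 
      (fun q => ⟨⟨gF x q.1, (gF_ok hx1 hx3 hx2 q.2).1⟩, (gF_ok hx1 hx3 hx2 q.2).2⟩) ?_ (Or.inl ?_) (H x hx3 hx1 hx2)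
    · intro p q h; exact fF_mono hy hx1 p.1.2 q.1.2 p.2 q.2 h
    · intro p q h; exact gF_mono h
    · intro p
      change rle p.1.1 (gF x (fF x p.1.1))
      rw [gF_fF hy hx1 p.1.2 p.2]; exact rle_refl _

theorem good_all (n : ℕ) : ∀ (Λ : Type) [Preorder Λ] [OrderBot Λ] (S : Sys M Λ) (_ : ∀ l c, c ∈ S.N l) (y : M.BraidMonoid) (_ : blen y ≤ n),
    Good (YY S y) := by
  induction n with
  | zero =>
    intro Λ _ _ S hS y hn
    obtain rfl := blen_eq_zero (b := y) (by omega)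
    refine good_of_le_const ⟨(⊥, 1, []), by simp, by simp, by simp, by simpa using S.ft, Or.inl (hS _ _), S.Alb⟩ ?_
    rintro ⟨⟨l, c, w⟩, h⟩
    have h1 := mul_eq_one_left h.hp
    have h2 := list_prod_one h.hne (mul_eq_one_right h.hp)
    simp only at h1 h2
    subst h1 h2
    exact ⟨bot_le, [], [], rfl, by simp, Rf.nil⟩
  | succ n ih =>
    intro Λ _ _ S hS y hn
    by_cases hy : y = 1
    · exact ih Λ S hS y (by rw [hy]; simp)
    apply step S y hy
    intro x hx hx1 hxy
    apply ih
    · rintro ⟨l, _ | _⟩ c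
      · simp [Sys.ext, hS]
      · simp [Sys.ext, hS]
    · obtain ⟨z, rfl⟩ := hxy
      rw [lq_mul]
      rw [ne_one_iff] at hx1
      rw [blen_mul] at hn
      omega

/-- upper part of a system -/
def Sys.up (S : Sys M Λ) (l : Λ) (c : M.BraidMonoid) (h : FT M (S.K l ∪ bsupp c)) (hA : S.Al l) : Sys M (Set.Ici l) where
  K m := S.K m.1 ∪ bsupp c
  N _ := Set.univ
  Kmono h := Set.union_subset_union_left _ (S.Kmono h)
  Nmono _ := subset_rfl
  Nmul _ _ _ _ := trivial
  Nnr _ _ _ := trivial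
  ft := h
  Al m := S.Al m.1
  Alb := hA

def GG (S : Sys M Λ) (y : M.BraidMonoid) : Type := 
  {p : Λ × M.BraidMonoid // p.2 ∣ y ∧ p.2 ∈ S.N p.1 ∧ FT M (S.K p.1 ∪ bsupp p.2) ∧ S.Al p.1}

instance (S : Sys M Λ) (y : M.BraidMonoid) : Preorder (GG S y) where
  le p q := p.1.1 ≤ q.1.1 ∧ p.1.2 ∣ q.1.2
  le_refl p := ⟨le_rfl, dvd_rfl⟩
  le_trans _ _ _ h h' := ⟨h.1.trans h'.1, h.2.trans h'.2⟩

lemma good_GG (S : Sys M Λ) (y z : M.BraidMonoid) (hz : z ∣ y) (hzK : bsupp z ⊆ S.K ⊥) (hzN : z ∈ S.N ⊥) : Good (GG S y) := by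
  have hz0 : FT M (S.K ⊥ ∪ bsupp z) := S.ft.mono (Set.union_subset subset_rfl hzK)
  refine good_zigzag (fun p : GG S y => (⟨(p.1.1, jn p.1.2 z), ?_, ?_, ?_, p.2.2.2.2⟩ : GG S y)) ?_ (⟨(⊥, z), hz, hzN, hz0, S.Alb⟩ : GG S y) (Or.inl ?_)
  · exact (jn_spec p.2.1 hz).2.2.1 y p.2.1 hz
  · obtain ⟨d, hd⟩ := (jn_spec p.2.1 hz).1
    simp only
    rw [hd]; exact S.Nmul _ _ _ p.2.2.1
  · refine p.2.2.2.1.mono ?_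
    refine Set.union_subset Set.subset_union_left ((jn_spec p.2.1 hz).2.2.2.trans ?_)
    refine Set.union_subset Set.subset_union_right ?_
    exact (hzK.trans (S.Kmono bot_le)).trans Set.subset_union_left
  · intro p q h
    refine ⟨h.1, ?_⟩
    have hq := jn_spec q.2.1 hz
    exact (jn_spec p.2.1 hz).2.2.1 _ (h.2.trans hq.1) hq.2.1
  · intro p
    have hp := jn_spec p.2.1 hz
    exact ⟨⟨le_rfl, hp.1⟩, ⟨bot_le, hp.2.1⟩⟩

theorem good_red (S : Sys M Λ) (y z : M.BraidMonoid) (hy : Rd y) (hz : z ∣ y) (hzK : bsupp z ⊆ S.K ⊥) (hzN : z ∈ S.N ⊥) : Good (YY S y) := by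
  have hN : ∀ p : YY S y, p.1.2.1 ∈ S.N p.1.1 := by
    intro p
    rcases p.2.hN with h | ⟨x, hx, h⟩
    · exact h
    · rw [← p.2.hp] at hy
      exact absurd (rd_list (rd_mul hy).2 x hx) h
  refine quillen (Q := GG S y) (fun p : YY S y => (⟨(p.1.1, p.1.2.1), ⟨_, p.2.hp.symm⟩, hN p, p.2.hK, p.2.hA⟩ : GG S y)) ?_ (good_GG S y z hz hzK hzN) ?_
  · intro p q h
    obtain ⟨h1, u, v, h2, h3, h4⟩ := h
    exact ⟨h1, ⟨_, h3⟩⟩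
  · rintro ⟨⟨l, c⟩, hc1, hc2, hc3, hc4⟩
    obtain ⟨y, rfl⟩ := hc1
    have hq : ∀ q : YY (S.up l c hc3 hc4) y, Ok S (c * y) (q.1.1.1, c * q.1.2.1, q.1.2.2) := by
      intro q
      refine ⟨?_, q.2.hne, q.2.hft, ?_, Or.inl ?_, q.2.hA⟩
      · simp only; rw [mul_assoc, q.2.hp]
      · have := q.2.hK
        simp only [Sys.up] at this
        simpa [bsupp_mul, Set.union_assoc] using this
      · exact S.Nmul _ _ _ (S.Nmono q.1.1.2 hc2)
    refine good_retract (Q := YY (S.up l c hc3 hc4) y) (fun p => (⟨(⟨p.1.1.1, p.2.1⟩, lq c p.1.1.2.1, p.1.1.2.2), ?_⟩ : YY (S.up l c hc3 hc4) y)) ?_ 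
      (fun q => ⟨⟨(q.1.1.1, c * q.1.2.1, q.1.2.2), hq q⟩, ⟨q.1.1.2, dvd_mul_right _ _⟩⟩) ?_ (Or.inl ?_) (good_all _ _ _ ?_ y le_rfl)
    · have hd : c ∣ p.1.1.2.1 := p.2.2
      refine ⟨?_, p.1.2.hne, p.1.2.hft, ?_, Or.inl trivial, p.1.2.hA⟩
      · have := p.1.2.hp
        rw [← mul_lq hd, mul_assoc] at this
        exact bcancel this
      · have := p.1.2.hK
        rw [← mul_lq hd, bsupp_mul, ← Set.union_assoc] at this
        exact this
    · intro p q h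
      have hd : c ∣ p.1.1.2.1 := p.2.2
      have hd' : c ∣ q.1.1.2.1 := q.2.2
      obtain ⟨h1, u, v, h2, h3, h4⟩ := h
      refine ⟨h1, u, v, h2, ?_, h4⟩
      rw [← mul_lq hd, ← mul_lq hd', mul_assoc] at h3
      exact bcancel h3
    · intro p q h
      obtain ⟨h1, u, v, h2, h3, h4⟩ := h
      refine ⟨h1, u, v, h2, ?_, h4⟩
      simp only
      rw [h3, mul_assoc]
    · intro p
      have hd : c ∣ p.1.1.2.1 := p.2.2
      change rle p.1.1 (p.1.1.1, c * lq c p.1.1.2.1, p.1.1.2.2)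
      rw [mul_lq hd]; exact rle_refl _
    · intro _ _; trivial

theorem good_nr (n : ℕ) : ∀ (Λ : Type) [Preorder Λ] [OrderBot Λ] (S : Sys M Λ) (y : M.BraidMonoid) (_ : ¬ Rd y) (_ : blen y ≤ n),
    Good (YY S y) := by
  induction n with
  | zero =>
    intro Λ _ _ S y hy hn
    obtain rfl := blen_eq_zero (b := y) (by omega)
    exact absurd rd_one hy
  | succ n ih =>
    intro Λ _ _ S y hy hn
    apply step S y (fun h => hy (h ▸ rd_one))
    intro x hx hx1 hxy
    obtain ⟨r, rfl⟩ := hxy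
    rw [lq_mul]
    by_cases hr : Rd r
    · obtain ⟨z, h1, h2, h3⟩ := A6 hr hy
      refine good_red _ r z hr h1 h2 ?_
      exact Or.inl h3
    · apply ih _ _ _ hr
      rw [ne_one_iff] at hx1
      rw [blen_mul] at hn
      omega

def S0 (M : CoxeterMatrix B) : Sys M Unit where
  K _ := ∅
  N _ := {c | ¬ Rd c}
  Kmono _ := subset_rfl
  Nmono _ := subset_rfl
  Nmul _ _ _ h h' := h (rd_mul h').1
  Nnr _ _ h := h
  ft := by simp [FT]
  Al _ := True
  Alb := trivial

noncomputable def gW (t : Unit × M.BraidMonoid × List M.BraidMonoid) : List M.BraidMonoid :=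
  open Classical in if t.2.1 = 1 then t.2.2 else t.2.1 :: t.2.2

lemma gW_rf {b : M.BraidMonoid} {t t'} (h : Ok (S0 M) b t) (hle : rle t t') : Rf (gW t) (gW t') := by
  obtain ⟨l, c, w⟩ := t
  obtain ⟨l', c', w'⟩ := t'
  obtain ⟨h1, u, v, h2, h3, h4⟩ := hle
  simp only at h2 h3 h4
  subst h2 h3
  by_cases hc : c = 1
  · subst hc
    by_cases hu : u = []
    · subst hu; simpa [gW] using h4
    · have hu1 : u.prod ≠ 1 := fun e => hu (list_prod_one (fun x hx => h.hne x (by simp [hx])) e)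
      have := Rf.cons u h4
      simpa [gW, hu1] using this
  · have hu1 : c * u.prod ≠ 1 := fun e => hc (mul_eq_one_left e)
    have := Rf.cons (c :: u) h4
    simpa [gW, hu1, hc] using this

theorem wfn_good (b : M.BraidMonoid) (hb : ¬ Rd b) : Good (WordFN M b) := by
  have hg : ∀ q : YY (S0 M) b, ∀ P : M.BraidMonoid → Prop, P q.1.2.1 → (∀ x ∈ q.1.2.2, P x) → ∀ x ∈ gW q.1, P x := by
    intro q P h1 h2 x hx
    unfold gW at hx
    split_ifs at hx
    · exact h2 x hx
    · rcases List.mem_cons.1 hx with rfl | hx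
      · exact h1
      · exact h2 x hx
  refine good_retract (Q := YY (S0 M) b) (fun w : WordFN M b => (⟨((), 1, w.letters), ?_⟩ : YY (S0 M) b)) ?_ 
    (fun q => (⟨gW q.1, ?_, ?_, ?_, ?_⟩ : WordFN M b)) ?_ (Or.inl ?_) (good_nr _ _ (S0 M) b hb le_rfl)
  · refine ⟨by simp [w.prod_eq], w.ne_one, fun x hx => (ft_iff x).1 (w.finite x hx), ?_, Or.inr ?_, trivial⟩
    · simp [S0, FT]
    · have := w.not_all_reduced
      push Not at this
      exact this
  · intro w w' h
    change rle ((), 1, w.letters) ((), 1, w'.letters)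
    induction h with
    | refl => exact rle_refl _
    | tail _ h ih => exact rle_trans ih ⟨le_rfl, [], _, rfl, by simp, (Rf.iff _ _).2 h⟩
  · have := q.2.hp
    unfold gW
    split_ifs with h
    · rwa [h, one_mul] at this
    · rwa [List.prod_cons]
  · intro x hx
    unfold gW at hx
    split_ifs at hx with h
    · exact q.2.hne x hx
    · rcases List.mem_cons.1 hx with rfl | hx
      · exact h
      · exact q.2.hne x hx
  · apply hg q
    · exact (ft_iff _).2 (q.2.hK.mono Set.subset_union_right)
    · intro x hx; exact (ft_iff _).2 (q.2.hft x hx)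
  · intro hall
    rcases q.2.hN with h | ⟨x, hx, h⟩
    · have h1 : q.1.2.1 ≠ 1 := by intro e; rw [e] at h; exact h rd_one
      exact h (hall _ (by simp [gW, h1]))
    · apply h (hall _ _)
      unfold gW
      split_ifs
      · exact hx
      · exact List.mem_cons_of_mem _ hx
  · intro p q h
    exact Relation.ReflTransGen.single ((Rf.iff _ _).1 (gW_rf p.2 h))
  · intro w
    apply Relation.ReflTransGen.single
    apply (Rf.iff _ _).1
    have : gW ((), 1, w.letters) = w.letters := by simp [gW]
    change Rf w.letters (gW ((), 1, w.letters))
    rw [this]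
    exact Rf.refl _

end final
end WFN
end partC2

/-- The poset of finite-type factorizations of a nonreduced braid with at least
one nonreduced letter is contractible. -/
theorem wordFN_contractible (M : CoxeterMatrix B) (b : M.BraidMonoid)
    (hb : ¬ M.ReducedBraid b) :
    ContractibleSpace (SSet.toTop.obj (nerve (WordFN M b))) := by
  exact WFN.wfn_good b hb
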